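/- arXiv:2301.00633 — 5 statements merged into one kernel-verified Lean document; each statement's English description precedes it below -/
import Mathlib

section
/- For every integer d ≥ 1 and n = 2^d, the Pascal toroidal array A_d is a nested (n,n,n,n)-perfect toroidal array. -/
/-- Entries of the Pascal-triangle matrix `M_d` (block recursive definition),
indexed by natural numbers. -/
def MdEnt : ℕ → ℕ → ℕ → ZMod 2
  | 0, _, _ => 1
  | d+1, i, j =>
    if i < 2 ^ d then
      if j < 2 ^ d then MdEnt d i j else MdEnt d i (j - 2 ^ d)
    else
      if j < 2 ^ d then 0 else MdEnt d (i - 2 ^ d) (j - 2 ^ d)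

/-- The matrix `M_d` over `𝔽₂`: `M_0 = (1)` and `M_{d+1} = [[M_d, M_d],[0, M_d]]`. -/
def Md (d : ℕ) : Matrix (Fin (2 ^ d)) (Fin (2 ^ d)) (ZMod 2) :=
  Matrix.of fun i j => MdEnt d (i : ℕ) (j : ℕ)

/-- The `s × t` array `P` occurs at position `(k, l)` in the toroidal array `A`. -/
def Occurs {N s t : ℕ} (A : ZMod N → ZMod N → ZMod 2)
    (P : Fin s → Fin t → ZMod 2) (k l : ZMod N) : Prop :=
  ∀ (i : Fin s) (j : Fin t), A (k + ((i : ℕ) : ZMod N)) (l + ((j : ℕ) : ZMod N)) = P i j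

/-- The toroidal array `A` of size `N × N` is `(s,t,p,q)`-perfect. -/
def IsPerfect (N s t p q : ℕ) (A : ZMod N → ZMod N → ZMod 2) : Prop :=
  ∀ (P : Fin s → Fin t → ZMod 2) (a b : ℕ), a < p → b < q →
    ∃! kl : Fin N × Fin N,
      (kl.1 : ℕ) % p = a ∧ (kl.2 : ℕ) % q = b ∧
        Occurs A P (((kl.1 : ℕ) : ZMod N)) (((kl.2 : ℕ) : ZMod N))

/-- `B` is an aligned subarray of `A` of size `L × L` (where `L` divides `N`). -/
def IsAlignedSub (N L : ℕ) (A : ZMod N → ZMod N → ZMod 2)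
    (B : ZMod L → ZMod L → ZMod 2) : Prop :=
  ∃ p q : ℕ, p < N / L ∧ q < N / L ∧
    ∀ (x y : Fin L),
      B ((x : ℕ) : ZMod L) ((y : ℕ) : ZMod L) =
        A (((p * L + (x : ℕ) : ℕ) : ZMod N)) (((q * L + (y : ℕ) : ℕ) : ZMod N))

/-- Nestedness of an `(n,n,n,n)`-perfect toroidal array of size
`n·2^{n²/2} × n·2^{n²/2}`. -/
def IsNested (n : ℕ)
    (A : ZMod (n * 2 ^ (n ^ 2 / 2)) → ZMod (n * 2 ^ (n ^ 2 / 2)) → ZMod 2) : Prop :=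
  ∀ k, 1 ≤ k → k ≤ n →
    ∀ B : ZMod (n * 2 ^ (n * k / 2)) → ZMod (n * 2 ^ (n * k / 2)) → ZMod 2,
      IsAlignedSub (n * 2 ^ (n ^ 2 / 2)) (n * 2 ^ (n * k / 2)) A B →
        IsPerfect (n * 2 ^ (n * k / 2)) k n n n B

/-- A nested `(n,n,n,n)`-perfect toroidal array. -/
def IsNestedPerfect (n : ℕ)
    (A : ZMod (n * 2 ^ (n ^ 2 / 2)) → ZMod (n * 2 ^ (n ^ 2 / 2)) → ZMod 2) : Prop :=
  IsPerfect (n * 2 ^ (n ^ 2 / 2)) n n n n A ∧ IsNested n A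

/-- `σ`: rotate a column vector downward by one step,
`(a_1,…,a_n) ↦ (a_n,a_1,…,a_{n-1})`. -/
def sigmaStep {n : ℕ} [NeZero n] (C : Fin n → ZMod 2) : Fin n → ZMod 2 :=
  fun i => C (i - 1)

instance instNeZeroTwoPow (d : ℕ) : NeZero (2 ^ d) := ⟨(Nat.two_pow_pos d).ne'⟩

/-- Admissibility of a sequence of rotation amounts `m_0,…,m_{n-1}`:
`m_{n-1} = 0` and `m_{i+1} ≤ m_i ≤ m_{i+1} + 1`. -/
def Admissible {n : ℕ} (m : Fin n → ℕ) : Prop :=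
  (∀ i : Fin n, (i : ℕ) = n - 1 → m i = 0) ∧
  ∀ i j : Fin n, (j : ℕ) = (i : ℕ) + 1 → m j ≤ m i ∧ m i ≤ m j + 1

/-- The Pascal-like matrix `M_d^{m_0,…,m_{n-1}}`: column `j` of `M_d`
rotated by `σ^{m_j}`. -/
def pascalLike (d : ℕ) (m : Fin (2 ^ d) → ℕ) :
    Matrix (Fin (2 ^ d)) (Fin (2 ^ d)) (ZMod 2) :=
  Matrix.of fun i j => (sigmaStep^[m j] (fun r => Md d r j)) i

/-- `M_{i,j}` lies in the upper border of `M`: it is the topmost `1` of its column. -/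
def UpperBorder {n : ℕ} (M : Matrix (Fin n) (Fin n) (ZMod 2)) (i j : Fin n) : Prop :=
  M i j = 1 ∧ ∀ r : Fin n, r < i → M r j = 0

/-- The enumeration `N_k` of all `n × n` matrices over `𝔽₂`:
entry `(i,j)` of `N_k` is the binary digit of `k` at position `n²−1−(i·n+j)`. -/
def Nmat (n k : ℕ) : Matrix (Fin n) (Fin n) (ZMod 2) :=
  Matrix.of fun i j =>
    if Nat.testBit k (n ^ 2 - 1 - ((i : ℕ) * n + (j : ℕ))) then 1 else 0

/-- The integer whose binary digit at position `t` is the digit of `k` at position `2t`. -/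
def evenPart (k : ℕ) : ℕ :=
  ∑ t ∈ Finset.range k, if Nat.testBit k (2 * t) then 2 ^ t else 0

/-- The integer whose binary digit at position `t` is the digit of `k` at position `2t+1`. -/
def oddPart (k : ℕ) : ℕ :=
  ∑ t ∈ Finset.range k, if Nat.testBit k (2 * t + 1) then 2 ^ t else 0

/-- The integer whose odd-position binary digits are those of `l` and whose
even-position binary digits are those of `m`; inverse of `k ↦ (oddPart k, evenPart k)`. -/
def joinOE (l m : ℕ) : ℕ :=
  ∑ t ∈ Finset.range (l + m + 1),
    ((if Nat.testBit l t then 2 ^ (2 * t + 1) else 0) +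
      (if Nat.testBit m t then 2 ^ (2 * t) else 0))

/-- The Pascal toroidal array `A_d` of size `n·2^{n²/2} × n·2^{n²/2}` (`n = 2^d`):
the matrix `M_d·N_k` is placed with upper left corner at `(odd(k)·n, even(k)·n)`. -/
def pascalArray (d : ℕ) :
    ZMod (2 ^ d * 2 ^ ((2 ^ d) ^ 2 / 2)) → ZMod (2 ^ d * 2 ^ ((2 ^ d) ^ 2 / 2)) → ZMod 2 :=
  fun x y =>
    (Md d * Nmat (2 ^ d) (joinOE (x.val / 2 ^ d) (y.val / 2 ^ d)))
      ⟨x.val % 2 ^ d, Nat.mod_lt _ (Nat.two_pow_pos d)⟩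
      ⟨y.val % 2 ^ d, Nat.mod_lt _ (Nat.two_pow_pos d)⟩

/-- The `(n,n,n,n)`-affine toroidal array determined by the Pascal-like matrix
given by rotations `m` and the matrix `Z`: the matrix `M·N_k ⊕ Z` is placed with
upper left corner at `(odd(k)·n, even(k)·n)`. -/
def affineArray (d : ℕ) (m : Fin (2 ^ d) → ℕ)
    (Z : Matrix (Fin (2 ^ d)) (Fin (2 ^ d)) (ZMod 2)) :
    ZMod (2 ^ d * 2 ^ ((2 ^ d) ^ 2 / 2)) → ZMod (2 ^ d * 2 ^ ((2 ^ d) ^ 2 / 2)) → ZMod 2 :=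
  fun x y =>
    (pascalLike d m * Nmat (2 ^ d) (joinOE (x.val / 2 ^ d) (y.val / 2 ^ d)) + Z)
      ⟨x.val % 2 ^ d, Nat.mod_lt _ (Nat.two_pow_pos d)⟩
      ⟨y.val % 2 ^ d, Nat.mod_lt _ (Nat.two_pow_pos d)⟩

open Polynomial in
lemma choose_add_two_pow (d j i : ℕ) :
    ((j + 2 ^ d).choose i : ZMod 2) = (j.choose i : ZMod 2) +
      if 2 ^ d ≤ i then (j.choose (i - 2 ^ d) : ZMod 2) else 0 := by
  have h : ((1 + X : (ZMod 2)[X])) ^ (j + 2 ^ d) = (1 + X) ^ j + (1 + X) ^ j * X ^ (2 ^ d) := by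
    rw [pow_add, add_pow_char_pow, one_pow]; ring
  have := congrArg (fun p => p.coeff i) h
  simpa [coeff_one_add_X_pow, coeff_mul_X_pow'] using this

lemma MdEnt_eq (d : ℕ) : ∀ i j, i < 2 ^ d → j < 2 ^ d → MdEnt d i j = (j.choose i : ZMod 2) := by
  induction d with
  | zero => intro i j hi hj; simp at hi hj; subst hi hj; simp [MdEnt]
  | succ d ih =>
    intro i j hi hj
    rw [pow_succ] at hi hj
    unfold MdEnt
    split_ifs with h1 h2 h3
    · exact ih _ _ h1 h2
    · rw [ih _ _ h1 (by omega)]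
      have := choose_add_two_pow d (j - 2 ^ d) i
      rw [Nat.sub_add_cancel (by omega), if_neg (by omega)] at this
      simp [this]
    · rw [Nat.choose_eq_zero_of_lt (by omega)]; simp
    · rw [ih _ _ (by omega) (by omega)]
      have := choose_add_two_pow d (j - 2 ^ d) i
      rw [Nat.sub_add_cancel (by omega), if_pos (by omega),
        Nat.choose_eq_zero_of_lt (n := j - 2 ^ d) (by omega)] at this
      simp [this]

/-- The polynomial `∑ v_c (1+X)^c`. -/
noncomputable def pol (n : ℕ) (v : ℕ → ZMod 2) : Polynomial (ZMod 2) :=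
  ∑ c ∈ Finset.range n, Polynomial.C (v c) * (1 + Polynomial.X) ^ c

lemma pol_coeff (n : ℕ) (v : ℕ → ZMod 2) (r : ℕ) :
    (pol n v).coeff r = ∑ c ∈ Finset.range n, (c.choose r : ZMod 2) * v c := by
  simp [pol, Polynomial.coeff_one_add_X_pow, mul_comm]

lemma pol_coeff_large (n : ℕ) (v : ℕ → ZMod 2) (r : ℕ) (hr : n ≤ r) :
    (pol n v).coeff r = 0 := by
  rw [pol_coeff]
  refine Finset.sum_eq_zero fun c hc => ?_
  rw [Nat.choose_eq_zero_of_lt (by simp at hc; omega)]; simp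

open Polynomial in
lemma pol_upper (n a : ℕ) (v : ℕ → ZMod 2)
    (h : ∀ r, a ≤ r → (pol n v).coeff r = 0) : ∀ c, a ≤ c → c < n → v c = 0 := by
  set P : (ZMod 2)[X] := ∑ c ∈ Finset.range n, C (v c) * X ^ c with hP
  have hc : pol n v = P.comp (1 + X) := by
    simp [pol, hP]
  have hPc : ∀ c, c < n → P.coeff c = v c := by
    intro c hc
    simp [hP, coeff_X_pow, hc]
  intro c hac hcn
  rw [← hPc c hcn]
  by_contra hne
  have hP0 : P ≠ 0 := by rintro h0; simp [h0] at hne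
  have h1 : c ≤ P.natDegree := le_natDegree_of_ne_zero hne
  have hdeg : (1 + X : (ZMod 2)[X]).natDegree = 1 := by
    rw [add_comm]; exact natDegree_X_add_C (1 : ZMod 2)
  have h2 : (pol n v).natDegree = P.natDegree := by
    rw [hc, natDegree_comp, hdeg, mul_one]
  have h3 := h (pol n v).natDegree (by omega)
  have h4 : pol n v = 0 := leadingCoeff_eq_zero.mp h3
  rw [hc, comp_eq_zero_iff] at h4
  rcases h4 with h4 | h4
  · exact hP0 h4
  · have := h4.2
    rw [this] at hdeg
    simp at hdeg

open Polynomial in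
lemma pol_factor (n s : ℕ) (v : ℕ → ZMod 2) (hv : ∀ c, c < s → v c = 0) :
    pol n v = (1 + X) ^ s * pol (n - s) (fun c => v (s + c)) := by
  rcases le_or_gt s n with hs | hs
  · obtain ⟨m, rfl⟩ := Nat.exists_eq_add_of_le hs
    unfold pol
    rw [Finset.sum_range_add, Finset.sum_eq_zero, zero_add, Finset.mul_sum, Nat.add_sub_cancel_left]
    · refine Finset.sum_congr rfl fun c _ => ?_
      rw [pow_add]; ring
    · intro c hc
      rw [hv c (by simpa using hc)]; simp
  · have : n - s = 0 := by omega
    rw [this]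
    unfold pol
    rw [Finset.sum_eq_zero]
    · simp
    · intro c hc
      rw [hv c (by simp at hc; omega)]; simp

open Polynomial in
lemma coprime_one_add_X (s m : ℕ) : IsCoprime ((X : (ZMod 2)[X]) ^ m) ((1 + X) ^ s) := by
  apply IsCoprime.pow
  exact ⟨-1, 1, by ring⟩

open Polynomial in
lemma pol_top (n s m : ℕ) (v : ℕ → ZMod 2) (hv : ∀ c, c < s → v c = 0)
    (hv2 : ∀ c, s + m ≤ c → c < n → v c = 0) (h : ∀ r, r < m → (pol n v).coeff r = 0) :
    ∀ c, c < n → v c = 0 := by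
  have hf := pol_factor n s v hv
  set g := pol (n - s) (fun c => v (s + c)) with hg
  have hdvd : X ^ m ∣ g := by
    have : X ^ m ∣ (1 + X) ^ s * g := by rw [← hf]; exact X_pow_dvd_iff.mpr h
    exact (coprime_one_add_X s m).dvd_of_dvd_mul_left this
  have hg0 : ∀ r, g.coeff r = 0 := by
    intro r
    rcases lt_or_ge r m with hr | hr
    · exact X_pow_dvd_iff.mp hdvd r hr
    · rw [hg, pol_coeff]
      refine Finset.sum_eq_zero fun c hcn => ?_
      rw [Finset.mem_range] at hcn
      rcases lt_or_ge c m with hc | hc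
      · rw [Nat.choose_eq_zero_of_lt (by omega)]; simp
      · rw [hv2 _ (by omega) (by omega)]; simp
  have : g = 0 := by ext r; simpa using hg0 r
  intro c hc
  exact pol_upper n 0 v (by intro r _; rw [hf, this]; simp) c (Nat.zero_le _) hc

open Polynomial in
lemma pol_cyc (d k a : ℕ) (hk : k ≤ 2 ^ d) (ha : a < 2 ^ d) (v : ℕ → ZMod 2)
    (hv : ∀ c, c < 2 ^ d - k → v c = 0)
    (h : ∀ i, i < k → (pol (2 ^ d) v).coeff ((a + i) % 2 ^ d) = 0) :
    ∀ c, c < 2 ^ d → v c = 0 := by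
  set n := 2 ^ d with hn
  set f := pol n v with hf
  set lo : (ZMod 2)[X] := ∑ i ∈ Finset.range a, C (f.coeff i) * X ^ i with hlo
  set hi : (ZMod 2)[X] := ∑ i ∈ Finset.range (n - a), C (f.coeff (a + i)) * X ^ i with hhi
  have loc : ∀ r, lo.coeff r = if r < a then f.coeff r else 0 := by
    intro r; simp [hlo, coeff_X_pow]
  have hic : ∀ r, hi.coeff r = f.coeff (a + r) := by
    intro r
    have : hi.coeff r = if r < n - a then f.coeff (a + r) else 0 := by
      simp [hhi, coeff_X_pow]
    rw [this]
    split_ifs with h1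
    · rfl
    · rw [hf, pol_coeff_large _ _ _ (by omega)]
  have hsplit : f = lo + X ^ a * hi := by
    ext r
    rw [coeff_add, loc, coeff_X_pow_mul', hic]
    split_ifs with h1 h2 h2
    · omega
    · simp
    · rw [zero_add]; congr 1; omega
    · omega
  set f' := hi + X ^ (n - a) * lo with hf'
  have hXn : (1 + X : (ZMod 2)[X]) ^ n = 1 + X ^ n := by
    rw [hn, add_pow_char_pow, one_pow]
  have h1 : X ^ a * f' = f + (1 + X) ^ n * lo := by
    rw [hXn, hf', hsplit]
    have e : (X : (ZMod 2)[X]) ^ n = X ^ a * X ^ (n - a) := by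
      rw [← pow_add]; congr 1; omega
    have e2 : lo + lo = 0 := CharTwo.add_self_eq_zero lo
    rw [e]
    linear_combination - e2
  have hd1 : (1 + X : (ZMod 2)[X]) ^ (n - k) ∣ f' := by
    have : (1 + X : (ZMod 2)[X]) ^ (n - k) ∣ X ^ a * f' := by
      rw [h1]
      refine dvd_add ?_ (Dvd.dvd.mul_right (pow_dvd_pow _ (by omega)) _)
      rw [hf, pol_factor n (n - k) v hv]
      exact dvd_mul_right _ _
    exact (coprime_one_add_X (n - k) a).symm.dvd_of_dvd_mul_left this
  have f'c : ∀ r, r < n → f'.coeff r = f.coeff ((a + r) % n) := by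
    intro r hr
    rw [hf', coeff_add, hic, coeff_X_pow_mul', loc]
    rcases lt_or_ge (a + r) n with h2 | h2
    · rw [if_neg (by omega), Nat.mod_eq_of_lt h2, add_zero]
    · rw [if_pos (by omega), if_pos (by omega), Nat.mod_eq_sub_mod h2,
        Nat.mod_eq_of_lt (by omega), hf, pol_coeff_large _ _ _ h2, zero_add]
      congr 1; omega
  have f'l : ∀ r, n ≤ r → f'.coeff r = 0 := by
    intro r hr
    rw [hf', coeff_add, hic, coeff_X_pow_mul', loc, hf, pol_coeff_large _ _ _ (by omega)]
    rw [if_pos (by omega), if_neg (by omega), add_zero]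
  have hd2 : X ^ k ∣ f' := by
    refine X_pow_dvd_iff.mpr fun r hr => ?_
    rw [f'c r (by omega), h r hr]
  have hd3 : X ^ k * (1 + X) ^ (n - k) ∣ f' := (coprime_one_add_X (n - k) k).mul_dvd hd2 hd1
  have hf'0 : f' = 0 := by
    by_contra hne
    have hmon : (1 + X : (ZMod 2)[X]).Monic := by rw [add_comm]; exact monic_X_add_C (1 : ZMod 2)
    have hdeg : (1 + X : (ZMod 2)[X]).natDegree = 1 := by
      rw [add_comm]; exact natDegree_X_add_C (1 : ZMod 2)
    have hle := natDegree_le_of_dvd hd3 hne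
    rw [(monic_X_pow k).natDegree_mul (hmon.pow _), natDegree_X_pow, hmon.natDegree_pow, hdeg] at hle
    have := f'l f'.natDegree (by omega)
    exact hne (leadingCoeff_eq_zero.mp this)
  refine fun c hc => pol_upper n 0 v (fun r _ => ?_) c (Nat.zero_le _) hc
  rcases lt_or_ge r n with hr | hr
  · rcases lt_or_ge r a with h2 | h2
    · have := f'c (r + n - a) (by omega)
      rw [hf'0, coeff_zero, show a + (r + n - a) = r + n by omega, Nat.add_mod_right,
        Nat.mod_eq_of_lt hr] at this
      exact this.symm
    · have := f'c (r - a) (by omega)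
      rw [hf'0, coeff_zero, show a + (r - a) = r by omega, Nat.mod_eq_of_lt hr] at this
      exact this.symm
  · exact pol_coeff_large _ _ _ hr

/-- A binary digit as an element of `ZMod 2`. -/
def bt (W t : ℕ) : ZMod 2 := if Nat.testBit W t then 1 else 0

lemma bt_sub_eq_zero (W W' t t' : ℕ) :
    bt W t - bt W' t' = 0 ↔ W.testBit t = W'.testBit t' := by
  unfold bt
  cases W.testBit t <;> cases W'.testBit t' <;> simp

lemma mod_succ_of_bit {X Y t : ℕ} (h : X % 2 ^ t = Y % 2 ^ t)
    (hb : X.testBit t = Y.testBit t) : X % 2 ^ (t + 1) = Y % 2 ^ (t + 1) := by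
  apply Nat.eq_of_testBit_eq
  intro i
  simp only [Nat.testBit_mod_two_pow]
  rcases lt_trichotomy i t with hi | hi | hi
  · have := congrArg (fun z => z.testBit i) h
    simp only [Nat.testBit_mod_two_pow] at this
    simpa [hi, Nat.lt_succ_of_lt hi] using this
  · subst hi; simp [hb]
  · have : ¬ i < t + 1 := by omega
    simp [this]

lemma bit_of_mod {X Y t K : ℕ} (h : X % 2 ^ K = Y % 2 ^ K) (ht : t < K) :
    X.testBit t = Y.testBit t := by
  have := congrArg (fun z => z.testBit t) h
  simpa [Nat.testBit_mod_two_pow, ht] using this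

lemma bit_mod {X t K : ℕ} (ht : t < K) : (X % 2 ^ K).testBit t = X.testBit t := by
  simp [Nat.testBit_mod_two_pow, ht]

lemma lowest_diff {X Y K : ℕ} (hX : X < 2 ^ K) (hY : Y < 2 ^ K) (hne : X ≠ Y) :
    ∃ t, t < K ∧ X % 2 ^ t = Y % 2 ^ t ∧ X.testBit t ≠ Y.testBit t := by
  by_contra hcon
  push Not at hcon
  have : ∀ t, t ≤ K → X % 2 ^ t = Y % 2 ^ t := by
    intro t
    induction t with
    | zero => intro _; simp [Nat.mod_one]
    | succ t ih =>
      intro ht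
      exact mod_succ_of_bit (ih (by omega)) (hcon t (by omega) (ih (by omega)))
  have h := this K le_rfl
  rw [Nat.mod_eq_of_lt hX, Nat.mod_eq_of_lt hY] at h
  exact hne h

lemma add_mod_eq {X Y t : ℕ} (e : ℕ) (h : X % 2 ^ t = Y % 2 ^ t) :
    (X + e) % 2 ^ t = (Y + e) % 2 ^ t := Nat.ModEq.add_right e h

lemma add_bit_ne {X Y t : ℕ} (e : ℕ) (h : X % 2 ^ t = Y % 2 ^ t)
    (hb : X.testBit t ≠ Y.testBit t) : (X + e).testBit t ≠ (Y + e).testBit t := by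
  intro hc
  have h1 := mod_succ_of_bit (add_mod_eq e h) hc
  have h2 : X % 2 ^ (t + 1) = Y % 2 ^ (t + 1) := Nat.ModEq.add_right_cancel' e h1
  exact hb (bit_of_mod h2 (Nat.lt_succ_self t))

/-- Digit position of entry `(c, 2e)` or `(c, 2e+1)`. -/
def pos (n h c e : ℕ) : ℕ := (n - 1 - c) * h + (h - 1 - e)

lemma pos_lt {n h c e k : ℕ} (hc : c < n) (he : e < h) (hk : n - k ≤ c) :
    pos n h c e < h * k := by
  unfold pos
  have h1 : n - 1 - c + 1 ≤ k := by omega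
  have h2 := Nat.mul_le_mul_right h h1
  rw [add_mul, one_mul, mul_comm k h] at h2
  omega

lemma pos_ge {n h c e k : ℕ} (hk : c < n - k) : h * k ≤ pos n h c e := by
  unfold pos
  have h1 : k ≤ n - 1 - c := by omega
  have h2 := Nat.mul_le_mul_right h h1
  rw [mul_comm k h] at h2
  omega

lemma pos_lt_pos {n h c i e : ℕ} (hc : c < n) (he : e < h) (hi : i < c) :
    pos n h c e < pos n h i e := by
  have := pos_lt (k := n - c) hc he (by omega)
  have h2 := pos_ge (n := n) (h := h) (c := i) (e := e) (k := n - c) (by omega)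
  omega

lemma exists_pos {n h k t : ℕ} (ht : t < h * k) (hk : k ≤ n) :
    ∃ c e, c < n ∧ n - k ≤ c ∧ e < h ∧ pos n h c e = t := by
  have hh : 0 < h := by
    rcases Nat.eq_zero_or_pos h with h0 | h0
    · simp [h0] at ht
    · exact h0
  have h1 : t / h < k := Nat.div_lt_of_lt_mul ht
  have h2 := Nat.mod_lt t hh
  have h3 := Nat.zero_le (t / h)
  generalize hu : t / h = u at h1 h3
  have hu2 := Nat.div_add_mod' t h
  rw [hu] at hu2
  refine ⟨n - 1 - u, h - 1 - t % h, by omega, by omega, by omega, ?_⟩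
  unfold pos
  rw [show n - 1 - (n - 1 - u) = u by omega,
    show h - 1 - (h - 1 - t % h) = t % h by omega]
  exact hu2

/-- Entry of `M_d * N` in row `r`, column `2e` or `2e+1`. -/
def Hent (d h k p W e r : ℕ) : ZMod 2 :=
  ∑ c ∈ Finset.range (2 ^ d), MdEnt d r c * bt (2 ^ (h * k) * p + W) (pos (2 ^ d) h c e)

/-- Difference of the columns. -/
def dl (d h k p W W' e : ℕ) : ℕ → ZMod 2 := fun c =>
  bt (2 ^ (h * k) * p + W) (pos (2 ^ d) h c e) - bt (2 ^ (h * k) * p + W') (pos (2 ^ d) h c e)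

lemma dl_coeff {d h k p W W' e r : ℕ} (hr : r < 2 ^ d)
    (hH : Hent d h k p W e r = Hent d h k p W' e r) :
    (pol (2 ^ d) (dl d h k p W W' e)).coeff r = 0 := by
  rw [pol_coeff, ← sub_eq_zero.mpr hH, Hent, Hent, ← Finset.sum_sub_distrib]
  refine Finset.sum_congr rfl fun c hc => ?_
  rw [MdEnt_eq d r c hr (by simpa using hc), dl, mul_sub]

lemma dl_low {d h k p W W' e c : ℕ} (hW : W < 2 ^ (h * k)) (hW' : W' < 2 ^ (h * k))
    (hc : c < 2 ^ d - k) : dl d h k p W W' e c = 0 := by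
  have := pos_ge (h := h) (e := e) hc
  rw [dl, bt_sub_eq_zero, Nat.testBit_two_pow_mul_add _ hW, Nat.testBit_two_pow_mul_add _ hW',
    if_neg (by omega), if_neg (by omega)]

lemma dl_high {d h k p W W' e c : ℕ} (hW : W < 2 ^ (h * k)) (hW' : W' < 2 ^ (h * k))
    (he : e < h) (hc : c < 2 ^ d) (hk : 2 ^ d - k ≤ c) :
    dl d h k p W W' e c = 0 ↔
      W.testBit (pos (2 ^ d) h c e) = W'.testBit (pos (2 ^ d) h c e) := by
  have := pos_lt hc he hk
  rw [dl, bt_sub_eq_zero, Nat.testBit_two_pow_mul_add _ hW, Nat.testBit_two_pow_mul_add _ hW',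
    if_pos (by omega), if_pos (by omega)]

lemma window_bits {d h k p a W W' e : ℕ} (hk : k ≤ 2 ^ d) (ha : a < 2 ^ d)
    (hW : W < 2 ^ (h * k)) (hW' : W' < 2 ^ (h * k)) (he : e < h)
    (hH : ∀ i, i < k → Hent d h k p W e ((a + i) % 2 ^ d) = Hent d h k p W' e ((a + i) % 2 ^ d)) :
    ∀ c, c < 2 ^ d → 2 ^ d - k ≤ c →
      W.testBit (pos (2 ^ d) h c e) = W'.testBit (pos (2 ^ d) h c e) := by
  intro c hc hkc
  rw [← dl_high (p := p) hW hW' he hc hkc]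
  exact pol_cyc d k a hk ha _ (fun c hc => dl_low hW hW' hc)
    (fun i hi => dl_coeff (Nat.mod_lt _ (Nat.two_pow_pos d)) (hH i hi)) c hc

lemma colY {d h k q a Y Y' : ℕ} (hk : k ≤ 2 ^ d) (ha : a < 2 ^ d) (ε : ℕ → ℕ)
    (hY : Y < 2 ^ (h * k)) (hY' : Y' < 2 ^ (h * k))
    (hH : ∀ e, e < h → ∀ i, i < k →
      Hent d h k q ((Y + ε e) % 2 ^ (h * k)) e ((a + i) % 2 ^ d) =
      Hent d h k q ((Y' + ε e) % 2 ^ (h * k)) e ((a + i) % 2 ^ d)) : Y = Y' := by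
  by_contra hne
  obtain ⟨t, ht, hmod, hb⟩ := lowest_diff hY hY' hne
  obtain ⟨c, e, hc, hkc, he, rfl⟩ := exists_pos ht hk
  have hT := Nat.two_pow_pos (h * k)
  have := window_bits hk ha (Nat.mod_lt _ hT) (Nat.mod_lt _ hT) he (hH e he) c hc hkc
  rw [bit_mod ht, bit_mod ht] at this
  exact add_bit_ne (ε e) hmod hb this

lemma rowX {d h k p a X X' : ℕ} (hk : k ≤ 2 ^ d) (ha : a < 2 ^ d)
    (hX : X < 2 ^ (h * k)) (hX' : X' < 2 ^ (h * k))
    (hH : ∀ e, e < h → ∀ i, i < k →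
      Hent d h k p ((X + if 2 ^ d ≤ a + i then 1 else 0) % 2 ^ (h * k)) e ((a + i) % 2 ^ d) =
      Hent d h k p ((X' + if 2 ^ d ≤ a + i then 1 else 0) % 2 ^ (h * k)) e ((a + i) % 2 ^ d)) :
    X = X' := by
  by_contra hne
  obtain ⟨t, ht, hmod, hb⟩ := lowest_diff hX hX' hne
  obtain ⟨s, e, hs, hks, he, rfl⟩ := exists_pos ht hk
  have hT := Nat.two_pow_pos (h * k)
  rcases Nat.lt_or_ge (2 ^ d) (a + k) with hw | hw
  · -- the window wraps around vertically
    have hsa : s < a := by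
      by_contra hsa
      have h0 := pol_upper (2 ^ d) a (dl d h k p X X' e) ?_ s (by omega) hs
      · rw [dl_high hX hX' he hs hks] at h0
        exact hb h0
      · intro r hr
        rcases Nat.lt_or_ge r (2 ^ d) with hrn | hrn
        · have := hH e he (r - a) (by omega)
          rw [show a + (r - a) = r by omega, if_neg (by omega), add_zero, add_zero,
            Nat.mod_eq_of_lt hX, Nat.mod_eq_of_lt hX', Nat.mod_eq_of_lt hrn] at this
          exact dl_coeff hrn this
        · exact pol_coeff_large _ _ _ hrn
    have hZ := Nat.mod_lt (X + 1) hT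
    have hZ' := Nat.mod_lt (X' + 1) hT
    have h0 := pol_top (2 ^ d) (2 ^ d - k) (a + k - 2 ^ d)
      (dl d h k p ((X + 1) % 2 ^ (h * k)) ((X' + 1) % 2 ^ (h * k)) e)
      (fun c hc => dl_low hZ hZ' hc) ?_ ?_ s hs
    · rw [dl_high hZ hZ' he hs hks, bit_mod ht, bit_mod ht] at h0
      exact add_bit_ne 1 hmod hb h0
    · intro c hc hcn
      have hlt := pos_lt_pos (n := 2 ^ d) (h := h) (c := c) (i := s) (e := e) hcn he (by omega)
      rw [dl_high hZ hZ' he hcn (by omega), bit_mod (by omega), bit_mod (by omega)]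
      exact bit_of_mod (add_mod_eq 1 hmod) hlt
    · intro r hr
      have := hH e he (r + 2 ^ d - a) (by omega)
      rw [show a + (r + 2 ^ d - a) = r + 2 ^ d by omega, if_pos (by omega), Nat.add_mod_right,
        Nat.mod_eq_of_lt (show r < 2 ^ d by omega)] at this
      exact dl_coeff (by omega) this
  · refine hb (window_bits (p := p) hk ha hX hX' he (fun i hi => ?_) s hs hks)
    have := hH e he i hi
    rwa [if_neg (by omega), add_zero, add_zero,
      Nat.mod_eq_of_lt hX, Nat.mod_eq_of_lt hX'] at this
lemma join_aux (l m N : ℕ) :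
    (∑ t ∈ Finset.range N, ((if Nat.testBit l t then 2 ^ (2 * t + 1) else 0) +
      (if Nat.testBit m t then 2 ^ (2 * t) else 0))) < 2 ^ (2 * N) ∧
    ∀ t, (∑ t ∈ Finset.range N, ((if Nat.testBit l t then 2 ^ (2 * t + 1) else 0) +
      (if Nat.testBit m t then 2 ^ (2 * t) else 0))).testBit (2 * t + 1) =
        (decide (t < N) && l.testBit t) ∧
      (∑ t ∈ Finset.range N, ((if Nat.testBit l t then 2 ^ (2 * t + 1) else 0) +
      (if Nat.testBit m t then 2 ^ (2 * t) else 0))).testBit (2 * t) =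
        (decide (t < N) && m.testBit t) := by
  induction N with
  | zero => simp
  | succ N ih =>
    obtain ⟨h1, h2⟩ := ih
    rw [Finset.sum_range_succ]
    set S := ∑ t ∈ Finset.range N, ((if Nat.testBit l t then 2 ^ (2 * t + 1) else 0) +
      (if Nat.testBit m t then 2 ^ (2 * t) else 0)) with hS
    have e1 : S + ((if Nat.testBit l N then 2 ^ (2 * N + 1) else 0) +
      (if Nat.testBit m N then 2 ^ (2 * N) else 0)) =
      2 ^ (2 * N) * (2 * (l.testBit N).toNat + (m.testBit N).toNat) + S := by
      cases l.testBit N <;> cases m.testBit N <;> simp <;> ring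
    rw [e1]
    constructor
    · have : 2 * (l.testBit N).toNat + (m.testBit N).toNat ≤ 3 := by
        cases l.testBit N <;> cases m.testBit N <;> simp
      have h3 := Nat.mul_le_mul_left (2 ^ (2 * N)) this
      rw [show 2 * (N + 1) = 2 * N + 2 by ring, pow_add]
      omega
    · intro t
      rw [Nat.testBit_two_pow_mul_add _ h1, Nat.testBit_two_pow_mul_add _ h1]
      rcases lt_trichotomy t N with ht | ht | ht
      · rw [if_pos (by omega), if_pos (by omega), (h2 t).1, (h2 t).2]
        simp [ht, Nat.lt_succ_of_lt ht]
      · subst ht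
        rw [if_neg (by omega), if_neg (by omega)]
        rw [show 2 * t + 1 - 2 * t = 1 by omega, show 2 * t - 2 * t = 0 by omega]
        cases l.testBit t <;> cases m.testBit t <;> simp <;> decide
      · rw [if_neg (by omega), if_neg (by omega)]
        have e2 : ∀ u, 2 ≤ u → (2 * (l.testBit N).toNat + (m.testBit N).toNat).testBit u = false := by
          intro u hu
          apply Nat.testBit_lt_two_pow
          have : 2 * (l.testBit N).toNat + (m.testBit N).toNat < 2 ^ 2 := by
            cases l.testBit N <;> cases m.testBit N <;> simp
          exact lt_of_lt_of_le this (Nat.pow_le_pow_right (by norm_num) hu)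
        rw [e2 _ (by omega), e2 _ (by omega)]
        have : ¬ t < N + 1 := by omega
        simp [this]

lemma testBit_big {l m t : ℕ} (h : ¬ t < l + m + 1) : l.testBit t = false := by
  apply Nat.testBit_lt_two_pow
  exact lt_of_lt_of_le Nat.lt_two_pow_self (Nat.pow_le_pow_right (by norm_num) (by omega))

lemma join_odd (l m t : ℕ) : (joinOE l m).testBit (2 * t + 1) = l.testBit t := by
  unfold joinOE
  rw [((join_aux l m _).2 t).1]
  by_cases h : t < l + m + 1
  · simp [h]
  · simp [testBit_big h]

lemma join_even (l m t : ℕ) : (joinOE l m).testBit (2 * t) = m.testBit t := by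
  unfold joinOE
  rw [((join_aux l m _).2 t).2]
  by_cases h : t < l + m + 1
  · simp [h]
  · rw [add_comm l m] at h
    simp [testBit_big h]

/-- The entry of `A_d` in terms of block and in-block indices. -/
def Gent (d l m r e : ℕ) : ZMod 2 :=
  ∑ c ∈ Finset.range (2 ^ d), MdEnt d r c * bt (joinOE l m) ((2 ^ d) ^ 2 - 1 - (c * 2 ^ d + e))

lemma pos_two {n h c e : ℕ} (hn : n = 2 * h) (hc : c < n) (he : e < n) :
    n ^ 2 - 1 - (c * n + e) = 2 * pos n h c (e / 2) + (if e % 2 = 0 then 1 else 0) := by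
  unfold pos
  obtain ⟨u, rfl⟩ : ∃ u, n = c + 1 + u := ⟨n - 1 - c, by omega⟩
  rw [show c + 1 + u - 1 - c = u by omega]
  have e1 : (c + 1 + u) ^ 2 = c * (c + 1 + u) + (c + 1 + u) + u * (c + 1 + u) := by ring
  have e2 : u * (c + 1 + u) = 2 * (u * h) := by rw [hn]; ring
  rw [e1, e2]
  split_ifs <;> omega

lemma Gent_eq {d h k p q X Y r e : ℕ} (hn : 2 ^ d = 2 * h) (he : e < 2 ^ d) :
    Gent d (2 ^ (h * k) * p + X) (2 ^ (h * k) * q + Y) r e =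
      if e % 2 = 0 then Hent d h k p X (e / 2) r else Hent d h k q Y (e / 2) r := by
  unfold Gent Hent
  split_ifs with h0 <;> refine Finset.sum_congr rfl fun c hc => ?_
  · rw [pos_two hn (by simpa using hc) he, if_pos h0]
    unfold bt
    rw [join_odd]
  · rw [pos_two hn (by simpa using hc) he, if_neg h0, add_zero]
    unfold bt
    rw [join_even]

lemma shift_entry {n T X a i : ℕ} (ha : a < n) (hi : i < n) :
    (X * n + a + i) % (n * T) / n = (X + if n ≤ a + i then 1 else 0) % T ∧
    (X * n + a + i) % (n * T) % n = (a + i) % n := by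
  constructor
  · rw [Nat.mod_mul_right_div_self]
    congr 1
    rw [show X * n + a + i = (a + i) + n * X by ring, Nat.add_mul_div_left _ _ (by omega),
      add_comm X]
    congr 1
    split_ifs with h
    · rw [Nat.div_eq_of_lt_le] <;> omega
    · exact Nat.div_eq_of_lt (by omega)
  · rw [Nat.mod_mul_right_mod, show X * n + a + i = (a + i) + n * X by ring,
      Nat.add_mul_mod_self_left]

lemma perfect_main {d h k p q T : ℕ} (hn : 2 ^ d = 2 * h) (hk : k ≤ 2 ^ d) (hk1 : 1 ≤ k)
    (hT : T = 2 ^ (h * k)) (B : ZMod (2 ^ d * T) → ZMod (2 ^ d * T) → ZMod 2)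
    (hB : ∀ x y : ℕ, x < 2 ^ d * T → y < 2 ^ d * T → B (x : ZMod (2 ^ d * T)) (y : ZMod (2 ^ d * T)) =
      Gent d (T * p + x / 2 ^ d) (T * q + y / 2 ^ d) (x % 2 ^ d) (y % 2 ^ d)) :
    IsPerfect (2 ^ d * T) k (2 ^ d) (2 ^ d) (2 ^ d) B := by
  intro P a b ha hb
  have hTpos : 0 < T := by rw [hT]; exact Nat.two_pow_pos _
  have hnpos : 0 < 2 ^ d := Nat.two_pow_pos d
  have hNpos : 0 < 2 ^ d * T := Nat.mul_pos hnpos hTpos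
  -- entries of the window
  have hent : ∀ X Y i j : ℕ, i < 2 ^ d → j < 2 ^ d →
      B (((X * 2 ^ d + a : ℕ) : ZMod (2 ^ d * T)) + (i : ZMod (2 ^ d * T)))
        (((Y * 2 ^ d + b : ℕ) : ZMod (2 ^ d * T)) + (j : ZMod (2 ^ d * T))) =
      if (b + j) % 2 ^ d % 2 = 0 then
        Hent d h k p ((X + if 2 ^ d ≤ a + i then 1 else 0) % T) ((b + j) % 2 ^ d / 2)
          ((a + i) % 2 ^ d)
      else Hent d h k q ((Y + if 2 ^ d ≤ b + j then 1 else 0) % T) ((b + j) % 2 ^ d / 2)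
          ((a + i) % 2 ^ d) := by
    intro X Y i j hi hj
    have hx : ((X * 2 ^ d + a : ℕ) : ZMod (2 ^ d * T)) + (i : ZMod (2 ^ d * T)) =
        (((X * 2 ^ d + a + i) % (2 ^ d * T) : ℕ) : ZMod (2 ^ d * T)) := by
      rw [ZMod.natCast_mod, Nat.cast_add (X * 2 ^ d + a) i]
    have hy : ((Y * 2 ^ d + b : ℕ) : ZMod (2 ^ d * T)) + (j : ZMod (2 ^ d * T)) =
        (((Y * 2 ^ d + b + j) % (2 ^ d * T) : ℕ) : ZMod (2 ^ d * T)) := by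
      rw [ZMod.natCast_mod, Nat.cast_add (Y * 2 ^ d + b) j]
    rw [hx, hy, hB _ _ (Nat.mod_lt _ hNpos) (Nat.mod_lt _ hNpos),
      (shift_entry ha hi).1, (shift_entry ha hi).2, (shift_entry hb hj).1, (shift_entry hb hj).2]
    subst hT
    exact Gent_eq hn (Nat.mod_lt _ hnpos)
  let φ : Fin T × Fin T → (Fin k → Fin (2 ^ d) → ZMod 2) := fun XY i j =>
    B ((((XY.1 : ℕ) * 2 ^ d + a : ℕ) : ZMod (2 ^ d * T)) + ((i : ℕ) : ZMod (2 ^ d * T)))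
        ((((XY.2 : ℕ) * 2 ^ d + b : ℕ) : ZMod (2 ^ d * T)) + ((j : ℕ) : ZMod (2 ^ d * T)))
  have hinj : Function.Injective φ := by
    rintro ⟨X, Y⟩ ⟨X', Y'⟩ hXY
    have key : ∀ i e : ℕ, i < k → e < 2 ^ d →
      (if e % 2 = 0 then
        Hent d h k p ((X + if 2 ^ d ≤ a + i then 1 else 0) % T) (e / 2) ((a + i) % 2 ^ d)
      else Hent d h k q ((Y + if e < b then 1 else 0) % T) (e / 2) ((a + i) % 2 ^ d)) =
      (if e % 2 = 0 then
        Hent d h k p ((X' + if 2 ^ d ≤ a + i then 1 else 0) % T) (e / 2) ((a + i) % 2 ^ d)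
      else Hent d h k q ((Y' + if e < b then 1 else 0) % T) (e / 2) ((a + i) % 2 ^ d)) := by
      intro i e hi he
      obtain ⟨j, hj, hje, hjb⟩ : ∃ j, j < 2 ^ d ∧ (b + j) % 2 ^ d = e ∧
          (2 ^ d ≤ b + j ↔ e < b) := by
        rcases Nat.lt_or_ge e b with h1 | h1
        · refine ⟨e + 2 ^ d - b, by omega, ?_, by omega⟩
          rw [show b + (e + 2 ^ d - b) = e + 2 ^ d by omega, Nat.add_mod_right,
            Nat.mod_eq_of_lt he]
        · refine ⟨e - b, by omega, ?_, by omega⟩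
          rw [show b + (e - b) = e by omega, Nat.mod_eq_of_lt he]
      have := congrFun (congrFun hXY ⟨i, hi⟩) ⟨j, hj⟩
      simp only [φ] at this
      rw [hent _ _ _ _ (by omega) hj, hent _ _ _ _ (by omega) hj] at this
      simpa only [hje, hjb] using this
    subst hT
    have hXX : (X : ℕ) = X' := by
      refine rowX (h := h) (p := p) hk ha X.2 X'.2 fun e he i hi => ?_
      have := key i (2 * e) hi (by omega)
      have h0 : 2 * e % 2 = 0 := by omega
      rw [if_pos h0, if_pos h0, show 2 * e / 2 = e by omega] at this
      exact this
    have hYY : (Y : ℕ) = Y' := by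
      refine colY (h := h) (q := q) hk ha (fun e => if 2 * e + 1 < b then 1 else 0) Y.2 Y'.2
        fun e he i hi => ?_
      have := key i (2 * e + 1) hi (by omega)
      have h0 : ¬ (2 * e + 1) % 2 = 0 := by omega
      rw [if_neg h0, if_neg h0, show (2 * e + 1) / 2 = e by omega] at this
      exact this
    exact Prod.ext (Fin.ext hXX) (Fin.ext hYY)
  have hbij : Function.Bijective φ := by
    refine (Fintype.bijective_iff_injective_and_card φ).mpr ⟨hinj, ?_⟩
    simp only [Fintype.card_prod, Fintype.card_fin, Fintype.card_fun, ZMod.card]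
    rw [hT, ← pow_add, ← pow_mul, hn]
    congr 1
    ring
  obtain ⟨⟨X, Y⟩, hXY, huniq⟩ := hbij.existsUnique P
  have bound : ∀ (X : Fin T) (a : ℕ), a < 2 ^ d → (X : ℕ) * 2 ^ d + a < 2 ^ d * T := by
    intro X a ha
    have := Nat.mul_le_mul_right (2 ^ d) (Nat.succ_le_of_lt X.2)
    rw [Nat.succ_mul, mul_comm T] at this
    omega
  refine ⟨(⟨X * 2 ^ d + a, bound X a ha⟩, ⟨Y * 2 ^ d + b, bound Y b hb⟩), ⟨?_, ?_, ?_⟩, ?_⟩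
  · simp [Nat.mod_eq_of_lt ha]
  · simp [Nat.mod_eq_of_lt hb]
  · intro i j
    exact congrFun (congrFun hXY i) j
  · rintro ⟨K, L⟩ ⟨h1, h2, h3⟩
    simp only at h1 h2 h3
    have hK := Nat.div_add_mod' (K : ℕ) (2 ^ d)
    have hL := Nat.div_add_mod' (L : ℕ) (2 ^ d)
    rw [h1] at hK
    rw [h2] at hL
    have := huniq (⟨K / 2 ^ d, Nat.div_lt_of_lt_mul K.2⟩, ⟨L / 2 ^ d, Nat.div_lt_of_lt_mul L.2⟩) (by
      funext i j
      simp only [φ]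
      rw [hK, hL]
      exact h3 i j)
    rw [Prod.mk.injEq] at this
    obtain ⟨rfl, rfl⟩ := this
    exact Prod.ext (Fin.ext hK.symm) (Fin.ext hL.symm)

lemma pascal_entry (d x y : ℕ) (hx : x < 2 ^ d * 2 ^ ((2 ^ d) ^ 2 / 2))
    (hy : y < 2 ^ d * 2 ^ ((2 ^ d) ^ 2 / 2)) :
    pascalArray d (x : ZMod (2 ^ d * 2 ^ ((2 ^ d) ^ 2 / 2)))
      (y : ZMod (2 ^ d * 2 ^ ((2 ^ d) ^ 2 / 2))) =
      Gent d (x / 2 ^ d) (y / 2 ^ d) (x % 2 ^ d) (y % 2 ^ d) := by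
  unfold pascalArray Gent
  simp only [ZMod.val_natCast_of_lt hx, ZMod.val_natCast_of_lt hy]
  rw [Matrix.mul_apply, Finset.sum_range]
  rfl

/-- For every `d ≥ 1` and `n = 2^d`, the Pascal toroidal array `A_d`
is a nested `(n,n,n,n)`-perfect toroidal array. -/
theorem pascalArray_nested_perfect (d : ℕ) (hd : 1 ≤ d) :
    IsNestedPerfect (2 ^ d) (pascalArray d) := by
  obtain ⟨h, hn⟩ : ∃ h, 2 ^ d = 2 * h := ⟨2 ^ (d - 1), by rw [← pow_succ']; congr 1; omega⟩
  have hnpos : 0 < 2 ^ d := Nat.two_pow_pos d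
  have hsq : (2 ^ d) ^ 2 / 2 = h * 2 ^ d := by
    rw [sq]; nth_rewrite 1 [hn]; rw [mul_assoc]; omega
  constructor
  · refine perfect_main (h := h) (p := 0) (q := 0) hn le_rfl hnpos (by rw [hsq]) _ ?_
    intro x y hx hy
    rw [pascal_entry d x y hx hy]
    simp
  · intro k hk1 hk B hsub
    obtain ⟨p, q, hp, hq, hB⟩ := hsub
    have hT : 2 ^ d * k / 2 = h * k := by rw [hn, mul_assoc]; omega
    refine perfect_main (h := h) (p := p) (q := q) hn hk hk1 (by rw [hT]) _ ?_
    intro x y hx hy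
    have lt : ∀ p x : ℕ, p < 2 ^ d * 2 ^ ((2 ^ d) ^ 2 / 2) / (2 ^ d * 2 ^ (2 ^ d * k / 2)) →
        x < 2 ^ d * 2 ^ (2 ^ d * k / 2) →
        p * (2 ^ d * 2 ^ (2 ^ d * k / 2)) + x < 2 ^ d * 2 ^ ((2 ^ d) ^ 2 / 2) := by
      intro p x hp hx
      have h1 := Nat.mul_le_mul_right (2 ^ d * 2 ^ (2 ^ d * k / 2)) (Nat.succ_le_of_lt hp)
      have h2 := Nat.div_mul_le_self (2 ^ d * 2 ^ ((2 ^ d) ^ 2 / 2)) (2 ^ d * 2 ^ (2 ^ d * k / 2))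
      rw [Nat.succ_mul] at h1
      omega
    have e : ∀ p x T : ℕ, (p * (2 ^ d * T) + x) / 2 ^ d = T * p + x / 2 ^ d ∧
        (p * (2 ^ d * T) + x) % 2 ^ d = x % 2 ^ d := by
      intro p x T
      rw [show p * (2 ^ d * T) + x = x + 2 ^ d * (T * p) by ring]
      rw [Nat.add_mul_div_left _ _ hnpos, Nat.add_mul_mod_self_left, add_comm]
      exact ⟨rfl, rfl⟩
    have := hB ⟨x, hx⟩ ⟨y, hy⟩
    simp only at this
    rw [this, pascal_entry d _ _ (lt p x hp hx) (lt q y hq hy)]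
    rw [(e p x _).1, (e p x _).2, (e q y _).1, (e q y _).2]
end

section
/- Let d ≥ 1, n = 2^d, let A be a toroidal array of size n·2^{n²/2} × n·2^{n²/2} over 𝔽₂, and let Z be an n × n matrix over 𝔽₂. Define the toroidal array A′ of the same size by A′(x,y) = A(x,y) + Z(x mod n, y mod n) (addition in 𝔽₂). Then A is a nested (n,n,n,n)-perfect toroidal array if and only if A′ is a nested (n,n,n,n)-perfect toroidal array. -/
def xorZ (n N : ℕ) (W : ℕ → ℕ → ZMod 2) (A : ZMod N → ZMod N → ZMod 2) :
    ZMod N → ZMod N → ZMod 2 :=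
  fun x y => A x y + W (x.val % n) (y.val % n)

theorem xorZ_xorZ (n N : ℕ) (W : ℕ → ℕ → ZMod 2) (A : ZMod N → ZMod N → ZMod 2) :
    xorZ n N W (xorZ n N W A) = A := by
  funext x y
  simp only [xorZ, add_assoc, CharTwo.add_self_eq_zero, add_zero]

theorem val_cast_mod {n N : ℕ} (h : n ∣ N) (a : ℕ) : ((a : ℕ) : ZMod N).val % n = a % n := by
  rw [ZMod.val_natCast, Nat.mod_mod_of_dvd _ h]

theorem xorZ_perfect {n N s t : ℕ} (h : n ∣ N) (W : ℕ → ℕ → ZMod 2)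
    (A : ZMod N → ZMod N → ZMod 2) (hA : IsPerfect N s t n n A) :
    IsPerfect N s t n n (xorZ n N W A) := by
  intro P a b ha hb
  have key := hA (fun i j => P i j + W ((a + i) % n) ((b + j) % n)) a b ha hb
  refine (existsUnique_congr ?_).mp key
  rintro ⟨k, l⟩
  refine and_congr_right fun hk => and_congr_right fun hl => ?_
  unfold Occurs
  refine forall_congr' fun i => forall_congr' fun j => ?_
  simp only at hk hl
  have e1 : (((k : ℕ) : ZMod N) + ((i : ℕ) : ZMod N)).val % n = (a + i) % n := by
    rw [← Nat.cast_add, val_cast_mod h, ← hk, Nat.mod_add_mod]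
  have e2 : (((l : ℕ) : ZMod N) + ((j : ℕ) : ZMod N)).val % n = (b + j) % n := by
    rw [← Nat.cast_add, val_cast_mod h, ← hl, Nat.mod_add_mod]
  simp only [xorZ, e1, e2]
  constructor
  · intro hh
    rw [hh, add_assoc, CharTwo.add_self_eq_zero, add_zero]
  · intro hh
    rw [← hh, add_assoc, CharTwo.add_self_eq_zero, add_zero]

theorem xorZ_sub {n N L : ℕ} (hN : n ∣ N) (hL : n ∣ L) (W : ℕ → ℕ → ZMod 2)
    (A : ZMod N → ZMod N → ZMod 2) (B : ZMod L → ZMod L → ZMod 2)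
    (hB : IsAlignedSub N L (xorZ n N W A) B) : IsAlignedSub N L A (xorZ n L W B) := by
  obtain ⟨p, q, hp, hq, h⟩ := hB
  refine ⟨p, q, hp, hq, fun x y => ?_⟩
  have e (u v : ℕ) : (u * L + v) % n = v % n := by
    obtain ⟨c, rfl⟩ := hL
    rw [show u * (n * c) + v = v + n * (u * c) by ring, Nat.add_mul_mod_self_left]
  simp only [xorZ, h x y, val_cast_mod hN, val_cast_mod hL, e]
  rw [add_assoc, CharTwo.add_self_eq_zero, add_zero]

theorem xorZ_nested (n : ℕ) (W : ℕ → ℕ → ZMod 2)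
    (A : ZMod (n * 2 ^ (n ^ 2 / 2)) → ZMod (n * 2 ^ (n ^ 2 / 2)) → ZMod 2)
    (hA : IsNestedPerfect n A) : IsNestedPerfect n (xorZ n _ W A) := by
  refine ⟨xorZ_perfect (Dvd.intro _ rfl) W A hA.1, fun k hk hkn B hB => ?_⟩
  have := xorZ_perfect (Dvd.intro _ rfl) W _
    (hA.2 k hk hkn _ (xorZ_sub (Dvd.intro _ rfl) (Dvd.intro _ rfl) W A B hB))
  rwa [xorZ_xorZ] at this

/-- For `d ≥ 1`, `n = 2^d`, a toroidal array `A` of size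
`n·2^{n²/2} × n·2^{n²/2}` over `𝔽₂` and an `n × n` matrix `Z`, the array
`A′(x,y) = A(x,y) + Z(x mod n, y mod n)` is nested `(n,n,n,n)`-perfect iff `A` is. -/
theorem nested_perfect_xor_iff (d : ℕ) (hd : 1 ≤ d)
    (A : ZMod (2 ^ d * 2 ^ ((2 ^ d) ^ 2 / 2)) → ZMod (2 ^ d * 2 ^ ((2 ^ d) ^ 2 / 2)) → ZMod 2)
    (Z : Matrix (Fin (2 ^ d)) (Fin (2 ^ d)) (ZMod 2)) :
    IsNestedPerfect (2 ^ d) A ↔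
      IsNestedPerfect (2 ^ d) (fun x y => A x y +
        Z ⟨x.val % 2 ^ d, Nat.mod_lt _ (Nat.two_pow_pos d)⟩
          ⟨y.val % 2 ^ d, Nat.mod_lt _ (Nat.two_pow_pos d)⟩) := by
  have hx : (fun x y => A x y +
        Z ⟨x.val % 2 ^ d, Nat.mod_lt _ (Nat.two_pow_pos d)⟩
          ⟨y.val % 2 ^ d, Nat.mod_lt _ (Nat.two_pow_pos d)⟩) =
      xorZ (2 ^ d) _ (fun a b => Z ⟨a % 2 ^ d, Nat.mod_lt _ (Nat.two_pow_pos d)⟩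
          ⟨b % 2 ^ d, Nat.mod_lt _ (Nat.two_pow_pos d)⟩) A := by
    funext x y
    simp only [xorZ, Nat.mod_mod]
  rw [hx]
  refine ⟨fun h => xorZ_nested _ _ A h, fun h => ?_⟩
  have h2 := xorZ_nested _ (fun a b => Z ⟨a % 2 ^ d, Nat.mod_lt _ (Nat.two_pow_pos d)⟩
          ⟨b % 2 ^ d, Nat.mod_lt _ (Nat.two_pow_pos d)⟩) _ h
  rwa [xorZ_xorZ] at h2
end

section
/- Let d ≥ 1 and n = 2^d. Every (n,n,n,n)-affine array (determined by a Pascal-like matrix M = M_d^{m_0,…,m_{n−1}} and an n × n matrix Z over 𝔽₂) is a nested (n,n,n,n)-perfect toroidal array. -/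
section Helpers
open Polynomial

theorem ap_frob (d : ℕ) : ((1 : (ZMod 2)[X]) + X) ^ (2 ^ d) = 1 + X ^ (2 ^ d) := by
  rw [add_pow_char_pow, one_pow]

theorem ap_natDegree (j : ℕ) : (((1 : (ZMod 2)[X]) + X) ^ j).natDegree ≤ j := by
  refine natDegree_pow_le.trans ?_
  have : ((1 : (ZMod 2)[X]) + X).natDegree ≤ 1 := by
    rw [add_comm]; exact (natDegree_X_add_C (1 : ZMod 2)).le
  nlinarith

theorem ap_coeff_top (j : ℕ) : (((1 : (ZMod 2)[X]) + X) ^ j).coeff j = 1 := by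
  rw [coeff_one_add_X_pow]; simp

theorem ap_coeff_big (j i : ℕ) (h : j < i) : (((1 : (ZMod 2)[X]) + X) ^ j).coeff i = 0 := by
  rw [coeff_one_add_X_pow, Nat.choose_eq_zero_of_lt h]; simp

theorem ap_MdEnt (d : ℕ) : ∀ i j, i < 2 ^ d → j < 2 ^ d →
    MdEnt d i j = (((1 : (ZMod 2)[X]) + X) ^ j).coeff i := by
  induction d with
  | zero =>
    intro i j hi hj
    have hi : i = 0 := by simpa using hi
    have hj : j = 0 := by simpa using hj
    subst hi hj; simp [MdEnt]
  | succ d ih =>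
    intro i j hi hj
    rw [pow_succ] at hi hj
    rw [MdEnt]
    by_cases hj' : j < 2 ^ d
    · by_cases hi' : i < 2 ^ d
      · simp [hi', hj', ih i j hi' hj']
      · simp only [hi', hj', if_true, if_false]
        rw [ap_coeff_big _ _ (by omega)]
    · have e : ((1 : (ZMod 2)[X]) + X) ^ j =
          (1 + X) ^ (j - 2 ^ d) + X ^ (2 ^ d) * (1 + X) ^ (j - 2 ^ d) := by
        conv_lhs => rw [show j = 2 ^ d + (j - 2 ^ d) by omega]
        rw [pow_add, ap_frob, add_mul, one_mul]
      rw [e, coeff_add, coeff_X_pow_mul']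
      by_cases hi' : i < 2 ^ d
      · simp [hi', hj', ih i (j - 2 ^ d) hi' (by omega)]
      · simp only [hi', hj', if_false]
        rw [ap_coeff_big _ _ (by omega), ih _ _ (by omega) (by omega),
          if_pos (by omega), zero_add]

theorem ap_adm {n : ℕ} {m : Fin n → ℕ} (hm : Admissible m) (s : ℕ) :
    ∀ i j : Fin n, (j : ℕ) = i + s → m j ≤ m i ∧ m i + i ≤ m j + j := by
  induction s with
  | zero =>
    intro i j h
    have : j = i := Fin.ext (by simpa using h)
    subst this; simp
  | succ s ih =>
    intro i j h
    have h1 := ih i ⟨i + s, by omega⟩ rfl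
    have h2 := hm.2 ⟨i + s, by omega⟩ j (by simp only; omega)
    simp only at h1
    omega

theorem ap_adm_le {n : ℕ} {m : Fin n → ℕ} (hm : Admissible m) (i j : Fin n) (h : i ≤ j) :
    m j ≤ m i ∧ m i + i ≤ m j + j :=
  ap_adm hm (j - i) i j (by have : (i : ℕ) ≤ j := h; omega)

theorem ap_adm_lt {n : ℕ} {m : Fin n → ℕ} (hm : Admissible m) (i : Fin n) : m i + i < n := by
  have hi := i.2
  have h := ap_adm_le hm i ⟨n - 1, by omega⟩ (by rw [Fin.le_def]; simp only; omega)
  have := hm.1 ⟨n - 1, by omega⟩ rfl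
  simp only at h
  omega

theorem ap_sigma {n : ℕ} [NeZero n] (s : ℕ) (C : Fin n → ZMod 2) (i : Fin n) (hs : s < n) :
    (sigmaStep^[s] C) i =
      if h : s ≤ i then C ⟨i - s, by omega⟩ else C ⟨n + i - s, by omega⟩ := by
  induction s generalizing C with
  | zero => simp
  | succ s ih =>
    rw [Function.iterate_succ_apply, ih _ (by omega)]
    have key : ∀ z : Fin n, 0 < (z : ℕ) → ((z - 1 : Fin n) : ℕ) = z - 1 := by
      intro z hz
      have h1 : ((1 : Fin n) : ℕ) = 1 := by
        rw [Fin.val_one']; exact Nat.mod_eq_of_lt (by omega)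
      rw [Fin.sub_val_of_le, h1]
      rw [Fin.le_def, h1]; omega
    have key0 : ∀ z : Fin n, (z : ℕ) = 0 → ((z - 1 : Fin n) : ℕ) = n - 1 := by
      intro z hz
      have h1 : ((1 : Fin n) : ℕ) = 1 := by
        rw [Fin.val_one']; exact Nat.mod_eq_of_lt (by omega)
      rw [Fin.val_sub, h1, hz, add_zero]; exact Nat.mod_eq_of_lt (by omega)
    unfold sigmaStep
    split_ifs with h1 h2 h2
    · congr 1; apply Fin.ext; rw [key _ (by simp only; omega)]; simp only; omega
    · congr 1; apply Fin.ext; rw [key0 _ (by simp only; omega)]; simp only; omega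
    · omega
    · congr 1; apply Fin.ext; rw [key _ (by simp only; omega)]; simp only; omega

theorem ap_pascalLike (d : ℕ) (m : Fin (2 ^ d) → ℕ) (hm : Admissible m) (i j : Fin (2 ^ d)) :
    pascalLike d m i j = ((X : (ZMod 2)[X]) ^ (m j) * (1 + X) ^ (j : ℕ)).coeff i := by
  have hlt := ap_adm_lt hm j
  rw [pascalLike, Matrix.of_apply, ap_sigma _ _ _ (by omega), coeff_X_pow_mul']
  split_ifs with h
  · rw [Md, Matrix.of_apply, ap_MdEnt _ _ _ (by simp only; omega) j.2]
  · rw [Md, Matrix.of_apply, ap_MdEnt _ _ _ (by simp only; omega) j.2, ap_coeff_big]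
    simp only; omega

/-- the polynomial of a combination of columns -/
noncomputable def apV {n : ℕ} (m : Fin n → ℕ) (u : Fin n → ZMod 2) : (ZMod 2)[X] :=
  ∑ l : Fin n, C (u l) * (X ^ (m l) * (1 + X) ^ (l : ℕ))

theorem apV_mulVec (d : ℕ) (m : Fin (2 ^ d) → ℕ) (hm : Admissible m) (u : Fin (2 ^ d) → ZMod 2)
    (i : Fin (2 ^ d)) : ∑ l, pascalLike d m i l * u l = (apV m u).coeff i := by
  rw [apV, finsetSum_coeff]
  refine Finset.sum_congr rfl fun l _ => ?_
  rw [coeff_C_mul, ap_pascalLike d m hm, mul_comm]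

theorem ap_col_coeff_low (s j i : ℕ) (h : i < s) :
    ((X : (ZMod 2)[X]) ^ s * (1 + X) ^ j).coeff i = 0 := by
  rw [coeff_X_pow_mul', if_neg (by omega)]

theorem ap_col_coeff_high (s j i : ℕ) (h : s + j < i) :
    ((X : (ZMod 2)[X]) ^ s * (1 + X) ^ j).coeff i = 0 := by
  rw [coeff_X_pow_mul', if_pos (by omega), ap_coeff_big _ _ (by omega)]

theorem apV_low {n : ℕ} {m : Fin n → ℕ} (hm : Admissible m) (u : Fin n → ZMod 2) (r : Fin n)
    (hu : ∀ l, r < l → u l = 0) (i : ℕ) (hi : i < m r) : (apV m u).coeff i = 0 := by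
  rw [apV, finsetSum_coeff]
  refine Finset.sum_eq_zero fun l _ => ?_
  rw [coeff_C_mul]
  by_cases h : r < l
  · rw [hu l h, zero_mul]
  · rw [ap_col_coeff_low, mul_zero]
    have := ap_adm_le hm l r (not_lt.mp h)
    omega

theorem apV_high {n : ℕ} {m : Fin n → ℕ} (hm : Admissible m) (u : Fin n → ZMod 2) (r : Fin n)
    (hu : ∀ l, r < l → u l = 0) (i : ℕ) (hi : m r + r < i) : (apV m u).coeff i = 0 := by
  rw [apV, finsetSum_coeff]
  refine Finset.sum_eq_zero fun l _ => ?_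
  rw [coeff_C_mul]
  by_cases h : r < l
  · rw [hu l h, zero_mul]
  · rw [ap_col_coeff_high, mul_zero]
    have := ap_adm_le hm l r (not_lt.mp h)
    omega

theorem ap_pivot {n : ℕ} {m : Fin n → ℕ} (hm : Admissible m) (r : Fin n) :
    ∃ ρ, (ρ = m r ∨ ρ = m r + r) ∧ ∀ u : Fin n → ZMod 2, (∀ l, r < l → u l = 0) →
      u r = 1 → (apV m u).coeff ρ = 1 := by
  by_cases hr : ∀ q : Fin n, (r : ℕ) = q + 1 → m q = m r
  · refine ⟨m r + r, Or.inr rfl, fun u hu hur => ?_⟩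
    rw [apV, finsetSum_coeff, Finset.sum_eq_single r]
    · rw [coeff_C_mul, hur, one_mul, coeff_X_pow_mul', if_pos (by omega)]
      rw [show m r + r - m r = (r : ℕ) by omega, ap_coeff_top]
    · intro l _ hl
      rw [coeff_C_mul]
      rcases lt_or_gt_of_ne hl with h | h
      · rw [ap_col_coeff_high, mul_zero]
        have h' : (l : ℕ) < r := h
        have h2 := hr ⟨r - 1, by omega⟩ (by simp only; omega)
        have := ap_adm_le hm l ⟨r - 1, by omega⟩ (by rw [Fin.le_def]; simp only; omega)
        simp only at this
        omega
      · rw [hu l h, zero_mul]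
    · simp
  · push Not at hr
    obtain ⟨q, hq, hne⟩ := hr
    have h1 := hm.2 q r hq
    refine ⟨m r, Or.inl rfl, fun u hu hur => ?_⟩
    rw [apV, finsetSum_coeff, Finset.sum_eq_single r]
    · rw [coeff_C_mul, hur, one_mul, coeff_X_pow_mul', if_pos le_rfl, coeff_one_add_X_pow]
      simp
    · intro l _ hl
      rw [coeff_C_mul]
      rcases lt_or_gt_of_ne hl with h | h
      · rw [ap_col_coeff_low, mul_zero]
        have h' : (l : ℕ) < r := h
        have := ap_adm_le hm l q (by rw [Fin.le_def]; omega)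
        omega
      · rw [hu l h, zero_mul]
    · simp

theorem ap_coprime (s k : ℕ) : IsCoprime (((1 : (ZMod 2)[X]) + X) ^ s) (X ^ k) := by
  apply IsCoprime.pow
  exact ⟨1, -1, by ring⟩

theorem ap_zero_of_dvd (V : (ZMod 2)[X]) (s : ℕ) (h : (1 + X) ^ s ∣ V)
    (hc : ∀ i, s ≤ i → V.coeff i = 0) : V = 0 := by
  have hmon : ((1 + X : (ZMod 2)[X]) ^ s).Monic := by
    rw [add_comm]; exact (monic_X_add_C (1 : ZMod 2)).pow s
  by_contra hV
  have h1 := natDegree_le_of_dvd h hV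
  have h2 : ((1 + X : (ZMod 2)[X]) ^ s).natDegree = s := by
    rw [add_comm, natDegree_pow, show (1 : (ZMod 2)[X]) = C 1 from rfl, natDegree_X_add_C, mul_one]
  have h3 := hc V.natDegree (by omega)
  exact hV (leadingCoeff_eq_zero.mp h3)

/-- Window lemma. -/
theorem ap_window (d k a : ℕ) (hk : k ≤ 2 ^ d) (ha : a < 2 ^ d) (V : (ZMod 2)[X])
    (hdvd : (1 + X) ^ (2 ^ d - k) ∣ V) (hdeg : ∀ i, 2 ^ d ≤ i → V.coeff i = 0)
    (h1 : ∀ i, a ≤ i → i < a + k → V.coeff i = 0)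
    (h2 : ∀ i, i + 2 ^ d < a + k → V.coeff i = 0) : V = 0 := by
  by_cases hw : a + k ≤ 2 ^ d
  · -- no wrap
    set e := 2 ^ d - (a + k) with he
    set c := a + k with hc
    have hfr := ap_frob d
    -- V = P + X^c Q
    set Q := V /ₘ X ^ c with hQ
    set P := V %ₘ X ^ c with hP
    have hVeq : P + X ^ c * Q = V := modByMonic_add_div V (X ^ c)
    have hPdeg : ∀ i, c ≤ i → P.coeff i = 0 := by
      intro i hi
      apply coeff_eq_zero_of_degree_lt
      have := degree_modByMonic_lt V (monic_X_pow (R := ZMod 2) c)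
      rw [degree_X_pow] at this
      exact lt_of_lt_of_le this (by exact_mod_cast hi)
    have hPc : ∀ i, i < c → P.coeff i = V.coeff i := by
      intro i hi
      rw [← hVeq, coeff_add, coeff_X_pow_mul', if_neg (by omega), add_zero]
    have hQc : ∀ i, Q.coeff i = V.coeff (i + c) := by
      intro i
      rw [← hVeq, coeff_add, coeff_X_pow_mul', if_pos (by omega), hPdeg _ (by omega), zero_add]
      congr 1; omega
    set W := X ^ e * P + Q with hW
    have hXn : X ^ e * X ^ c = (1 + (1 + X) ^ (2 ^ d) : (ZMod 2)[X]) := by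
      rw [hfr, ← pow_add, show e + c = 2 ^ d by omega, ← add_assoc, CharTwo.add_self_eq_zero,
        zero_add]
    have hWV : W = X ^ e * V + (1 + X) ^ (2 ^ d) * Q := by
      rw [hW, ← hVeq, mul_add, ← mul_assoc, hXn, add_mul, one_mul, add_assoc, add_assoc,
        CharTwo.add_self_eq_zero, add_zero]
    have hWd : (1 + X) ^ (2 ^ d - k) ∣ W := by
      rw [hWV]
      exact dvd_add (hdvd.mul_left _) ((pow_dvd_pow _ (by omega)).mul_right _)
    have hW0 : W = 0 := by
      apply ap_zero_of_dvd W _ hWd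
      intro i hi
      rw [hW, coeff_add, coeff_X_pow_mul', hQc, hdeg (i + c) (by omega), add_zero,
        if_pos (by omega)]
      by_cases h : i - e < c
      · rw [hPc _ h, h1 _ (by omega) (by omega)]
      · exact hPdeg _ (by omega)
    have hcf : ∀ i, (X ^ e * P).coeff i + Q.coeff i = 0 := by
      intro i
      rw [← coeff_add, ← hW, hW0, coeff_zero]
    ext i
    rw [coeff_zero]
    by_cases hi : i < c
    · have := hcf (i + e)
      rw [coeff_X_pow_mul', if_pos (by omega), hQc, hdeg (i + e + c) (by omega), add_zero,
        show i + e - e = i by omega, hPc _ hi] at this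
      exact this
    · by_cases hi2 : i < 2 ^ d
      · have := hcf (i - c)
        rw [coeff_X_pow_mul', if_neg (by omega), hQc, zero_add,
          show i - c + c = i by omega] at this
        exact this
      · exact hdeg i (by omega)
  · -- wrap
    set h := a + k - 2 ^ d with hh
    have hX : X ^ h ∣ V := by
      rw [X_pow_dvd_iff]
      intro i hi
      exact h2 i (by omega)
    obtain ⟨V', rfl⟩ := hX
    have hd' : (1 + X) ^ (2 ^ d - k) ∣ V' := (ap_coprime _ _).dvd_of_dvd_mul_left hdvd
    rw [ap_zero_of_dvd V' _ hd', mul_zero]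
    intro i hi
    have : V'.coeff i = (X ^ h * V').coeff (i + h) := by
      rw [coeff_X_pow_mul', if_pos (by omega)]; congr 1; omega
    rw [this]
    by_cases hi' : i + h < a + k
    · exact h1 _ (by omega) hi'
    · exact hdeg _ (by omega)

theorem apV_dvd {n : ℕ} (m : Fin n → ℕ) (u : Fin n → ZMod 2) (s : ℕ)
    (hu : ∀ l : Fin n, (l : ℕ) < s → u l = 0) : (1 + X) ^ s ∣ apV m u := by
  refine Finset.dvd_sum fun l _ => ?_
  by_cases h : (l : ℕ) < s
  · rw [hu l h]; simp
  · exact ((pow_dvd_pow _ (by omega)).mul_left _).mul_left _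

/-- Key lemma. -/
theorem ap_key (d k a : ℕ) (hk : k ≤ 2 ^ d) (ha : a < 2 ^ d) (m : Fin (2 ^ d) → ℕ)
    (hm : Admissible m) (u v : Fin (2 ^ d) → ZMod 2) (r : Fin (2 ^ d))
    (hu : ∀ l, r < l → u l = 0) (hv : ∀ l, r < l → v l = 0)
    (hu' : ∀ l : Fin (2 ^ d), (l : ℕ) < 2 ^ d - k → u l = 0)
    (hv' : ∀ l : Fin (2 ^ d), (l : ℕ) < 2 ^ d - k → v l = 0)
    (hur : u r = 1) (hvr : v r = 1)
    (h1 : ∀ i, a ≤ i → i < 2 ^ d → i < a + k → (apV m u).coeff i = 0)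
    (h2 : ∀ i, i + 2 ^ d < a + k → (apV m v).coeff i = 0) : False := by
  obtain ⟨ρ, hρ, hp⟩ := ap_pivot hm r
  have hlt := ap_adm_lt hm r
  have hpu := hp u hu hur
  have hpv := hp v hv hvr
  have hdu : ∀ i, 2 ^ d ≤ i → (apV m u).coeff i = 0 := fun i hi =>
    apV_high hm u r hu i (by omega)
  have hdv : ∀ i, 2 ^ d ≤ i → (apV m v).coeff i = 0 := fun i hi =>
    apV_high hm v r hv i (by omega)
  by_cases hA : m r + r < a
  · have : apV m v = 0 := by
      apply ap_window d k a hk ha _ (apV_dvd m v _ hv') hdv _ h2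
      intro i hi _
      exact apV_high hm v r hv i (by omega)
    rw [this, coeff_zero] at hpv
    exact zero_ne_one hpv
  by_cases hB : a + k ≤ 2 ^ d + m r
  · have : apV m u = 0 := by
      apply ap_window d k a hk ha _ (apV_dvd m u _ hu') hdu
      · intro i hi hi'
        by_cases h : i < 2 ^ d
        · exact h1 i hi h hi'
        · exact hdu i (by omega)
      · intro i hi
        exact apV_low hm u r hu i (by omega)
    rw [this, coeff_zero] at hpu
    exact zero_ne_one hpu
  rcases hρ with rfl | rfl
  · rw [h2 _ (by omega)] at hpv; exact zero_ne_one hpv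
  · rw [h1 _ (by omega) (by omega) (by omega)] at hpu; exact zero_ne_one hpu

end Helpers

section Bits

theorem ap_testBit_sum (K : ℕ) : ∀ (f g : ℕ → Bool) (t : ℕ), t < K →
    Nat.testBit (∑ t ∈ Finset.range K, ((if f t then 2 ^ (2 * t + 1) else 0) +
      (if g t then 2 ^ (2 * t) else 0))) (2 * t) = g t ∧
    Nat.testBit (∑ t ∈ Finset.range K, ((if f t then 2 ^ (2 * t + 1) else 0) +
      (if g t then 2 ^ (2 * t) else 0))) (2 * t + 1) = f t := by
  induction K with
  | zero => intro f g t ht; omega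
  | succ K ih =>
    intro f g t ht
    rw [Finset.sum_range_succ']
    have e : ∑ t ∈ Finset.range K, ((if f (t + 1) then 2 ^ (2 * (t + 1) + 1) else 0) +
        (if g (t + 1) then 2 ^ (2 * (t + 1)) else 0)) =
        4 * ∑ t ∈ Finset.range K, ((if f (t + 1) then 2 ^ (2 * t + 1) else 0) +
        (if g (t + 1) then 2 ^ (2 * t) else 0)) := by
      rw [Finset.mul_sum]
      refine Finset.sum_congr rfl fun s _ => ?_
      split_ifs <;> ring
    rw [e]
    have := fun s hs => ih (fun t => f (t + 1)) (fun t => g (t + 1)) s hs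
    set S := ∑ t ∈ Finset.range K, ((if f (t + 1) then 2 ^ (2 * t + 1) else 0) +
        (if g (t + 1) then 2 ^ (2 * t) else 0)) with hS
    have e2 : 4 * S + ((if f 0 then 2 ^ (2 * 0 + 1) else 0) + (if g 0 then 2 ^ (2 * 0) else 0)) =
        2 ^ 2 * S + ((if f 0 then 2 else 0) + (if g 0 then 1 else 0)) := by simp
    rw [e2]
    have hb : ((if f 0 then 2 else 0) + (if g 0 then 1 else 0)) < 2 ^ 2 := by
      split_ifs <;> norm_num
    cases t with
    | zero =>
      rw [Nat.testBit_two_pow_mul_add _ hb, Nat.testBit_two_pow_mul_add _ hb]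
      simp only [show 2 * 0 < 2 from by norm_num, show 2 * 0 + 1 < 2 from by norm_num, if_true]
      cases f 0 <;> cases g 0 <;> decide
    | succ t =>
      rw [Nat.testBit_two_pow_mul_add _ hb, Nat.testBit_two_pow_mul_add _ hb,
        if_neg (by omega), if_neg (by omega), show 2 * (t + 1) - 2 = 2 * t by omega,
        show 2 * (t + 1) + 1 - 2 = 2 * t + 1 by omega]
      exact this t (by omega)

theorem ap_joinOE (l m t : ℕ) : Nat.testBit (joinOE l m) (2 * t) = Nat.testBit m t ∧
    Nat.testBit (joinOE l m) (2 * t + 1) = Nat.testBit l t := by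
  unfold joinOE
  by_cases ht : t < l + m + 1
  · exact ap_testBit_sum _ _ _ t ht
  · -- extend the range
    have hz : ∀ s, l + m + 1 ≤ s → Nat.testBit l s = false ∧ Nat.testBit m s = false := by
      intro s hs
      have : s < 2 ^ s := Nat.lt_two_pow_self
      exact ⟨Nat.testBit_lt_two_pow (by omega), Nat.testBit_lt_two_pow (by omega)⟩
    have e : ∑ t ∈ Finset.range (l + m + 1), ((if Nat.testBit l t then 2 ^ (2 * t + 1) else 0) +
      (if Nat.testBit m t then 2 ^ (2 * t) else 0)) =
      ∑ t ∈ Finset.range (t + 1), ((if Nat.testBit l t then 2 ^ (2 * t + 1) else 0) +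
      (if Nat.testBit m t then 2 ^ (2 * t) else 0)) := by
      apply Finset.sum_subset
      · intro s hs; rw [Finset.mem_range] at *; omega
      · intro s _ hs
        rw [Finset.mem_range] at hs
        simp [hz s (by omega)]
    rw [e]
    exact ap_testBit_sum _ _ _ t (by omega)

theorem ap_testBit_of_mod {x y t s : ℕ} (h : x % 2 ^ t = y % 2 ^ t) (hs : s < t) :
    Nat.testBit x s = Nat.testBit y s := by
  have h1 := Nat.testBit_mod_two_pow x t s
  have h2 := Nat.testBit_mod_two_pow y t s
  simp only [hs, decide_true, Bool.true_and] at h1 h2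
  rw [← h1, ← h2, h]

theorem ap_testBit_ne {x y t : ℕ} (h : x % 2 ^ t = y % 2 ^ t)
    (h' : x % 2 ^ (t + 1) ≠ y % 2 ^ (t + 1)) : Nat.testBit x t ≠ Nat.testBit y t := by
  intro hb
  apply h'
  apply Nat.eq_of_testBit_eq
  intro i
  rw [Nat.testBit_mod_two_pow, Nat.testBit_mod_two_pow]
  by_cases hi : i < t
  · rw [ap_testBit_of_mod h hi]
  · by_cases hi' : i = t
    · rw [hi', hb]
    · simp [show ¬ i < t + 1 by omega]

theorem ap_lowest {x y K : ℕ} (hx : x < 2 ^ K) (hy : y < 2 ^ K) (hne : x ≠ y) :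
    ∃ t < K, x ≡ y [MOD 2 ^ t] ∧ ¬ x ≡ y [MOD 2 ^ (t + 1)] := by
  have hK : ¬ x ≡ y [MOD 2 ^ K] := by
    unfold Nat.ModEq
    rwa [Nat.mod_eq_of_lt hx, Nat.mod_eq_of_lt hy]
  have hex : ∃ t, ¬ x ≡ y [MOD 2 ^ t] := ⟨K, hK⟩
  classical
  set t := Nat.find hex with ht
  have h1 : ¬ x ≡ y [MOD 2 ^ t] := Nat.find_spec hex
  have h2 : t ≤ K := Nat.find_min' hex hK
  have h0 : t ≠ 0 := by
    intro h; rw [h] at h1; exact h1 (by simp [Nat.modEq_one])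
  refine ⟨t - 1, by omega, ?_, by rwa [show t - 1 + 1 = t by omega]⟩
  by_contra h
  exact Nat.find_min hex (m := t - 1) (by omega) h

/-- 0/1 value of a bit -/
def apBit (x s : ℕ) : ZMod 2 := if Nat.testBit x s then 1 else 0

theorem apBit_sub_of_ne {x y s t : ℕ} (h : Nat.testBit x s ≠ Nat.testBit y t) :
    apBit x s - apBit y t = 1 := by
  unfold apBit
  revert h
  cases Nat.testBit x s <;> cases Nat.testBit y t <;> decide

/-- properties of the bit-differences. -/
theorem ap_bits {x y K t : ℕ} (P e : ℕ) (ht : t < K) (h1 : x ≡ y [MOD 2 ^ t])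
    (h2 : ¬ x ≡ y [MOD 2 ^ (t + 1)]) :
    (∀ s, s < t → apBit (P * 2 ^ K + (x + e) % 2 ^ K) s =
      apBit (P * 2 ^ K + (y + e) % 2 ^ K) s) ∧
    (∀ s, K ≤ s → apBit (P * 2 ^ K + (x + e) % 2 ^ K) s =
      apBit (P * 2 ^ K + (y + e) % 2 ^ K) s) ∧
    apBit (P * 2 ^ K + (x + e) % 2 ^ K) t - apBit (P * 2 ^ K + (y + e) % 2 ^ K) t = 1 := by
  have key : ∀ z s, Nat.testBit (P * 2 ^ K + z % 2 ^ K) s =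
      if s < K then Nat.testBit z s else Nat.testBit P (s - K) := by
    intro z s
    rw [mul_comm, Nat.testBit_two_pow_mul_add _ (Nat.mod_lt _ (Nat.two_pow_pos K)),
      Nat.testBit_mod_two_pow]
    split_ifs with h <;> simp [h]
  have h1' : x + e ≡ y + e [MOD 2 ^ t] := h1.add_right e
  have h2' : ¬ x + e ≡ y + e [MOD 2 ^ (t + 1)] := fun h => h2 (Nat.ModEq.add_right_cancel' e h)
  refine ⟨?_, ?_, ?_⟩
  · intro s hs
    unfold apBit
    have hsK : s < K := by omega
    simp only [key, if_pos hsK, ap_testBit_of_mod h1' hs]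
  · intro s hs
    unfold apBit
    have hsK : ¬ s < K := by omega
    simp only [key, if_neg hsK]
  · apply apBit_sub_of_ne
    rw [key, key, if_pos ht, if_pos ht]
    exact ap_testBit_ne h1' h2'

/-- bit position of an entry -/
def apTau (n H i c : ℕ) : ℕ := n * H - 1 - (i * H + c / 2)

theorem ap_Nmat (n H x y : ℕ) (hn : n = 2 * H) (i c : Fin n) :
    Nmat n (joinOE x y) i c =
      apBit (if (c : ℕ) % 2 = 0 then x else y) (apTau n H i c) := by
  obtain ⟨i, hi⟩ := i
  obtain ⟨c, hc⟩ := c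
  have hsq : n ^ 2 = 2 * (n * H) := by rw [hn]; ring
  have hin : i * n = 2 * (i * H) := by rw [hn]; ring
  have hle : i * H + H ≤ n * H := by
    calc i * H + H = (i + 1) * H := by ring
      _ ≤ n * H := Nat.mul_le_mul_right _ hi
  simp only [Nmat, Matrix.of_apply, apBit, apTau]
  have key : (joinOE x y).testBit (n ^ 2 - 1 - (i * n + c)) =
      (if c % 2 = 0 then x else y).testBit (n * H - 1 - (i * H + c / 2)) := by
    rw [hsq, hin]
    split_ifs with h
    · rw [show 2 * (n * H) - 1 - (2 * (i * H) + c) = 2 * (n * H - 1 - (i * H + c / 2)) + 1 by omega,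
        (ap_joinOE _ _ _).2]
    · rw [show 2 * (n * H) - 1 - (2 * (i * H) + c) = 2 * (n * H - 1 - (i * H + c / 2)) by omega,
        (ap_joinOE _ _ _).1]
  simp only [key]
  split_ifs <;> rfl

/-- Core contradiction: no two block indices give the same column contents. -/
theorem ap_core (d k a H K P q : ℕ) (hn : 2 ^ d = 2 * H) (hK : K = k * H)
    (hk : k ≤ 2 ^ d) (ha : a < 2 ^ d)
    (m : Fin (2 ^ d) → ℕ) (hm : Admissible m) (x y : ℕ) (hx : x < 2 ^ K) (hy : y < 2 ^ K)
    (hq : q < 2) (ε : ℕ → Fin (2 ^ d) → ℕ)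
    (hε : ∀ c, (∃ e, ∀ i, ε i c = e) ∨ ∀ i, ε i c = (a + i) / 2 ^ d)
    (hcol : ∀ (i : ℕ) (c : Fin (2 ^ d)), i < k → (c : ℕ) % 2 = q →
      ∑ l, pascalLike d m ⟨(a + i) % 2 ^ d, Nat.mod_lt _ (Nat.two_pow_pos d)⟩ l *
        apBit (P * 2 ^ K + (x + ε i c) % 2 ^ K) (apTau (2 ^ d) H l c) =
      ∑ l, pascalLike d m ⟨(a + i) % 2 ^ d, Nat.mod_lt _ (Nat.two_pow_pos d)⟩ l *
        apBit (P * 2 ^ K + (y + ε i c) % 2 ^ K) (apTau (2 ^ d) H l c)) : x = y := by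
  by_contra hne
  obtain ⟨t, htK, ht1, ht2⟩ := ap_lowest hx hy hne
  have hHpos : 0 < H := by
    have := Nat.two_pow_pos d
    omega
  have hkH : k * H ≤ 2 ^ d * H := Nat.mul_le_mul_right _ hk
  set E := (2 ^ d) * H - 1 - t with hE
  have hElt : E < (2 ^ d) * H := by omega
  have hrlt : E / H < (2 ^ d) := by rw [Nat.div_lt_iff_lt_mul hHpos]; exact hElt
  have hEm : E % H < H := Nat.mod_lt _ hHpos
  set r : Fin (2 ^ d) := ⟨E / H, hrlt⟩ with hr
  set c : Fin (2 ^ d) := ⟨2 * (E % H) + q, by omega⟩ with hc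
  have hcd : (c : ℕ) / 2 = E % H := by simp only [hc]; omega
  have hcm : (c : ℕ) % 2 = q := by simp only [hc]; omega
  have hEdiv : E / H * H + E % H = E := by rw [mul_comm]; exact Nat.div_add_mod E H
  have hτr : apTau (2 ^ d) H r c = t := by
    unfold apTau
    rw [hcd]
    simp only [hr]
    omega
  have hτgt : ∀ l : Fin (2 ^ d), r < l → apTau (2 ^ d) H l c < t := by
    intro l hl
    unfold apTau
    rw [hcd]
    have h1 : E / H + 1 ≤ (l : ℕ) := hl
    have h2 : (E / H + 1) * H ≤ l * H := Nat.mul_le_mul_right _ h1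
    have h3 : (l + 1) * H ≤ (2 ^ d) * H := Nat.mul_le_mul_right _ l.2
    rw [add_mul, one_mul] at h2 h3
    omega
  have hτlow : ∀ l : Fin (2 ^ d), (l : ℕ) < (2 ^ d) - k → K ≤ apTau (2 ^ d) H l c := by
    intro l hl
    unfold apTau
    rw [hcd, hK]
    have h1 : (l + 1 + k) * H ≤ (2 ^ d) * H := Nat.mul_le_mul_right _ (by omega)
    rw [add_mul, add_mul, one_mul] at h1
    omega
  set u : ℕ → Fin (2 ^ d) → ZMod 2 := fun e l =>
    apBit (P * 2 ^ K + (x + e) % 2 ^ K) (apTau (2 ^ d) H l c) -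
    apBit (P * 2 ^ K + (y + e) % 2 ^ K) (apTau (2 ^ d) H l c) with hu
  have hu1 : ∀ e l, r < l → u e l = 0 := fun e l hl =>
    sub_eq_zero.mpr ((ap_bits P e htK ht1 ht2).1 _ (hτgt l hl))
  have hu2 : ∀ e (l : Fin (2 ^ d)), (l : ℕ) < (2 ^ d) - k → u e l = 0 := fun e l hl =>
    sub_eq_zero.mpr ((ap_bits P e htK ht1 ht2).2.1 _ (hτlow l hl))
  have hu3 : ∀ e, u e r = 1 := fun e => by
    simp only [hu]
    rw [hτr]
    exact (ap_bits P e htK ht1 ht2).2.2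
  have hV : ∀ i, i < k → (apV m (u (ε i c))).coeff ((a + i) % (2 ^ d)) = 0 := by
    intro i hi
    have h := hcol i c hi hcm
    have h' := apV_mulVec d m hm (u (ε i c)) ⟨(a + i) % (2 ^ d), Nat.mod_lt _ (Nat.two_pow_pos d)⟩
    rw [← h']
    simp only [hu, mul_sub]
    rw [Finset.sum_sub_distrib, h, sub_self]
  have fin : ∀ e e', (∀ i, i < k → a + i < (2 ^ d) → ε i c = e) →
      (∀ i, i < k → (2 ^ d) ≤ a + i → ε i c = e') → False := by
    intro e e' he he'
    refine ap_key d k a hk ha m hm (u e) (u e') r (hu1 e) (hu1 e') (hu2 e) (hu2 e') (hu3 e)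
      (hu3 e') ?_ ?_
    · intro i h1 h2 h3
      have := hV (i - a) (by omega)
      rwa [he (i - a) (by omega) (by omega), show a + (i - a) = i by omega,
        Nat.mod_eq_of_lt h2] at this
    · intro i h1
      have := hV (i + (2 ^ d) - a) (by omega)
      rwa [he' (i + (2 ^ d) - a) (by omega) (by omega), show a + (i + (2 ^ d) - a) = i + (2 ^ d) by omega,
        Nat.add_mod_right, Nat.mod_eq_of_lt (by omega)] at this
  rcases hε c with ⟨e, he⟩ | he
  · exact fin e e (fun i _ _ => he i) (fun i _ _ => he i)
  · refine fin 0 1 (fun i _ h => ?_) (fun i hi h => ?_)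
    · rw [he, Nat.div_eq_of_lt h]
    · rw [he]
      exact Nat.div_eq_of_lt_le (by omega) (by omega)

/-- entry function of the blocks -/
noncomputable def apG (d : ℕ) (m : Fin (2 ^ d) → ℕ) (Z : Matrix (Fin (2 ^ d)) (Fin (2 ^ d)) (ZMod 2))
    (X Y s t : ℕ) : ZMod 2 :=
  (pascalLike d m * Nmat (2 ^ d) (joinOE X Y) + Z)
      ⟨s % 2 ^ d, Nat.mod_lt _ (Nat.two_pow_pos d)⟩
      ⟨t % 2 ^ d, Nat.mod_lt _ (Nat.two_pow_pos d)⟩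

theorem apG_eq (d H : ℕ) (hn : 2 ^ d = 2 * H) (m : Fin (2 ^ d) → ℕ)
    (Z : Matrix (Fin (2 ^ d)) (Fin (2 ^ d)) (ZMod 2)) (X Y s t : ℕ) :
    apG d m Z X Y s t =
      ∑ l, pascalLike d m ⟨s % 2 ^ d, Nat.mod_lt _ (Nat.two_pow_pos d)⟩ l *
        apBit (if (t % 2 ^ d) % 2 = 0 then X else Y) (apTau (2 ^ d) H l (t % 2 ^ d)) +
      Z ⟨s % 2 ^ d, Nat.mod_lt _ (Nat.two_pow_pos d)⟩
        ⟨t % 2 ^ d, Nat.mod_lt _ (Nat.two_pow_pos d)⟩ := by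
  unfold apG
  rw [Matrix.add_apply, Matrix.mul_apply]
  congr 1
  refine Finset.sum_congr rfl fun l _ => ?_
  rw [ap_Nmat _ H _ _ hn]

theorem ap_perfect (d k H K p q : ℕ) (hn : 2 ^ d = 2 * H) (hK : K = k * H)
    (hk : k ≤ 2 ^ d) (m : Fin (2 ^ d) → ℕ) (hm : Admissible m)
    (Z : Matrix (Fin (2 ^ d)) (Fin (2 ^ d)) (ZMod 2))
    (B : ZMod (2 ^ d * 2 ^ K) → ZMod (2 ^ d * 2 ^ K) → ZMod 2)
    (hB : ∀ s t : ℕ, B (s : ZMod _) (t : ZMod _) =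
      apG d m Z (p * 2 ^ K + (s / 2 ^ d) % 2 ^ K) (q * 2 ^ K + (t / 2 ^ d) % 2 ^ K) s t) :
    IsPerfect (2 ^ d * 2 ^ K) k (2 ^ d) (2 ^ d) (2 ^ d) B := by
  intro P a b ha hb
  have hnpos := Nat.two_pow_pos d
  let Φ : Fin (2 ^ K) × Fin (2 ^ K) → (Fin k → Fin (2 ^ d) → ZMod 2) := fun xy i j =>
    B ((2 ^ d * xy.1 + a + i : ℕ) : ZMod _) ((2 ^ d * xy.2 + b + j : ℕ) : ZMod _)
  have hdiv : ∀ x a i : ℕ, (2 ^ d * x + a + i) / 2 ^ d = x + (a + i) / 2 ^ d := by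
    intro x a i
    rw [add_assoc, Nat.mul_add_div hnpos]
  have hmod : ∀ x a i : ℕ, (2 ^ d * x + a + i) % 2 ^ d = (a + i) % 2 ^ d := by
    intro x a i
    rw [add_assoc, Nat.mul_add_mod]
  -- index of pattern column for each array column
  have hjc : ∀ c : Fin (2 ^ d), (b + (c + 2 ^ d - b) % 2 ^ d) % 2 ^ d = c := by
    intro c
    rw [Nat.add_mod_mod, show b + (c + 2 ^ d - b) = c + 2 ^ d by omega, Nat.add_mod_right,
      Nat.mod_eq_of_lt c.2]
  have hinj : Function.Injective Φ := by
    rintro ⟨x, y⟩ ⟨x', y'⟩ h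
    have hval : ∀ (i : ℕ) (c : Fin (2 ^ d)), i < k →
        ∑ l, pascalLike d m ⟨(a + i) % 2 ^ d, Nat.mod_lt _ (Nat.two_pow_pos d)⟩ l *
          apBit (if (c : ℕ) % 2 = 0 then p * 2 ^ K + (x + (a + i) / 2 ^ d) % 2 ^ K else
            q * 2 ^ K + (y + (b + (c + 2 ^ d - b) % 2 ^ d) / 2 ^ d) % 2 ^ K)
            (apTau (2 ^ d) H l c) =
        ∑ l, pascalLike d m ⟨(a + i) % 2 ^ d, Nat.mod_lt _ (Nat.two_pow_pos d)⟩ l *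
          apBit (if (c : ℕ) % 2 = 0 then p * 2 ^ K + (x' + (a + i) / 2 ^ d) % 2 ^ K else
            q * 2 ^ K + (y' + (b + (c + 2 ^ d - b) % 2 ^ d) / 2 ^ d) % 2 ^ K)
            (apTau (2 ^ d) H l c) := by
      intro i c hi
      have h1 := congrFun (congrFun h ⟨i, hi⟩) ⟨(c + 2 ^ d - b) % 2 ^ d, Nat.mod_lt _ hnpos⟩
      simp only [Φ] at h1
      rw [hB, hB, apG_eq d H hn, apG_eq d H hn] at h1
      simp only [hdiv, hmod, hjc] at h1
      exact add_right_cancel h1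
    have hx : (x : ℕ) = x' := by
      refine ap_core d k a H K p 0 hn hK hk ha m hm x x' x.2 x'.2 (by norm_num)
        (fun i _ => (a + i) / 2 ^ d) (fun c => Or.inr fun i => rfl) ?_
      intro i c hi hc
      have := hval i c hi
      simp only [hc, if_true] at this
      exact this
    have hy : (y : ℕ) = y' := by
      refine ap_core d k a H K q 1 hn hK hk ha m hm y y' y.2 y'.2 (by norm_num)
        (fun _ c => (b + (c + 2 ^ d - b) % 2 ^ d) / 2 ^ d) (fun c => Or.inl ⟨_, fun i => rfl⟩) ?_
      intro i c hi hc
      have := hval i c hi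
      simp only [hc, one_ne_zero, if_false] at this
      exact this
    rw [Prod.mk.injEq]
    exact ⟨Fin.ext hx, Fin.ext hy⟩
  have hbij : Function.Bijective Φ := by
    rw [Fintype.bijective_iff_injective_and_card]
    refine ⟨hinj, ?_⟩
    simp only [Fintype.card_prod, Fintype.card_fin, Fintype.card_fun, ZMod.card]
    rw [← pow_add, ← pow_mul, hn, hK]
    congr 1; ring
  have hocc : ∀ x y : Fin (2 ^ K), Occurs B P ((2 ^ d * x + a : ℕ) : ZMod _)
      ((2 ^ d * y + b : ℕ) : ZMod _) ↔ Φ (x, y) = P := by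
    intro x y
    unfold Occurs
    constructor
    · intro h
      funext i j
      rw [← h i j]
      simp only [Φ]
      push_cast
      rfl
    · intro h i j
      rw [← h]
      simp only [Φ]
      push_cast
      rfl
  have hlt : ∀ (x : Fin (2 ^ K)) (a : ℕ), a < 2 ^ d → 2 ^ d * (x : ℕ) + a < 2 ^ d * 2 ^ K := by
    intro x a ha
    calc 2 ^ d * (x : ℕ) + a < 2 ^ d * (x : ℕ) + 2 ^ d := by omega
      _ = 2 ^ d * (x + 1) := by ring
      _ ≤ _ := Nat.mul_le_mul_left _ x.2
  obtain ⟨⟨x, y⟩, hxy⟩ := hbij.2 P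
  refine ⟨(⟨2 ^ d * x + a, hlt x a ha⟩, ⟨2 ^ d * y + b, hlt y b hb⟩), ⟨?_, ?_, ?_⟩, ?_⟩
  · simp only
    rw [Nat.mul_add_mod, Nat.mod_eq_of_lt ha]
  · simp only
    rw [Nat.mul_add_mod, Nat.mod_eq_of_lt hb]
  · exact (hocc x y).mpr hxy
  · rintro ⟨⟨s, hs⟩, ⟨t, ht⟩⟩ ⟨h1, h2, h3⟩
    simp only at h1 h2 h3
    have hs' : s / 2 ^ d < 2 ^ K := Nat.div_lt_of_lt_mul hs
    have ht' : t / 2 ^ d < 2 ^ K := Nat.div_lt_of_lt_mul ht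
    have es : 2 ^ d * (s / 2 ^ d) + a = s := by rw [← h1]; exact Nat.div_add_mod s _
    have et : 2 ^ d * (t / 2 ^ d) + b = t := by rw [← h2]; exact Nat.div_add_mod t _
    have h4 := (hocc ⟨s / 2 ^ d, hs'⟩ ⟨t / 2 ^ d, ht'⟩).mp (by simp only [es, et]; exact h3)
    have h5 := hinj (h4.trans hxy.symm)
    rw [Prod.mk.injEq] at h5
    obtain ⟨rfl, rfl⟩ := h5
    simp only [es, et]

theorem ap_affine (d : ℕ) (m : Fin (2 ^ d) → ℕ) (Z : Matrix (Fin (2 ^ d)) (Fin (2 ^ d)) (ZMod 2))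
    (s t : ℕ) (hs : s < 2 ^ d * 2 ^ ((2 ^ d) ^ 2 / 2)) (ht : t < 2 ^ d * 2 ^ ((2 ^ d) ^ 2 / 2)) :
    affineArray d m Z (s : ZMod _) (t : ZMod _) = apG d m Z (s / 2 ^ d) (t / 2 ^ d) s t := by
  unfold affineArray apG
  simp only [ZMod.val_natCast, Nat.mod_eq_of_lt hs, Nat.mod_eq_of_lt ht]

theorem ap_sub (d k H K : ℕ) (hn : 2 ^ d = 2 * H) (hK : K = k * H)
    (hk : k ≤ 2 ^ d) (m : Fin (2 ^ d) → ℕ) (hm : Admissible m)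
    (Z : Matrix (Fin (2 ^ d)) (Fin (2 ^ d)) (ZMod 2))
    (B : ZMod (2 ^ d * 2 ^ K) → ZMod (2 ^ d * 2 ^ K) → ZMod 2)
    (hB : IsAlignedSub (2 ^ d * 2 ^ ((2 ^ d) ^ 2 / 2)) (2 ^ d * 2 ^ K) (affineArray d m Z) B) :
    IsPerfect (2 ^ d * 2 ^ K) k (2 ^ d) (2 ^ d) (2 ^ d) B := by
  obtain ⟨p, q, hp, hq, h⟩ := hB
  have hnpos := Nat.two_pow_pos d
  have hLpos : 0 < 2 ^ d * 2 ^ K := by positivity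
  have hlt : ∀ p x L N : ℕ, p < N / L → x < L → p * L + x < N := by
    intro p x L N hp hx
    calc p * L + x < (p + 1) * L := by rw [add_mul, one_mul]; omega
      _ ≤ N / L * L := Nat.mul_le_mul_right _ hp
      _ ≤ N := Nat.div_mul_le_self _ _
  refine ap_perfect d k H K p q hn hK hk m hm Z B ?_
  intro s t
  have hs := Nat.mod_lt s hLpos
  have ht := Nat.mod_lt t hLpos
  have h1 := h ⟨s % (2 ^ d * 2 ^ K), hs⟩ ⟨t % (2 ^ d * 2 ^ K), ht⟩
  simp only [ZMod.natCast_mod] at h1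
  have hd1 : ∀ p s : ℕ, (p * (2 ^ d * 2 ^ K) + s % (2 ^ d * 2 ^ K)) / 2 ^ d =
      p * 2 ^ K + s / 2 ^ d % 2 ^ K := by
    intro p s
    rw [show p * (2 ^ d * 2 ^ K) = 2 ^ d * (p * 2 ^ K) by ring, Nat.mul_add_div hnpos,
      Nat.mod_mul_right_div_self]
  have hm1 : ∀ p s : ℕ, (p * (2 ^ d * 2 ^ K) + s % (2 ^ d * 2 ^ K)) % 2 ^ d = s % 2 ^ d := by
    intro p s
    rw [show p * (2 ^ d * 2 ^ K) = 2 ^ d * (p * 2 ^ K) by ring, Nat.mul_add_mod,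
      Nat.mod_mul_right_mod]
  rw [h1, ap_affine d m Z _ _ (hlt _ _ _ _ hp hs) (hlt _ _ _ _ hq ht), hd1, hd1]
  unfold apG
  simp only [hm1]

end Bits

/-- For `d ≥ 1` and `n = 2^d`, every `(n,n,n,n)`-affine array
(determined by a Pascal-like matrix and an `n × n` matrix `Z` over `𝔽₂`) is a
nested `(n,n,n,n)`-perfect toroidal array. -/
theorem affineArray_nested_perfect (d : ℕ) (hd : 1 ≤ d) (m : Fin (2 ^ d) → ℕ)
    (hm : Admissible m) (Z : Matrix (Fin (2 ^ d)) (Fin (2 ^ d)) (ZMod 2)) :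
    IsNestedPerfect (2 ^ d) (affineArray d m Z) := by
  obtain ⟨e, rfl⟩ : ∃ e, d = e + 1 := ⟨d - 1, by omega⟩
  have hn : 2 ^ (e + 1) = 2 * 2 ^ e := by rw [pow_succ, mul_comm]
  have hkk : ∀ k, 2 ^ (e + 1) * k / 2 = k * 2 ^ e := by
    intro k
    rw [hn, mul_assoc, Nat.mul_div_cancel_left _ (by norm_num), mul_comm]
  refine ⟨?_, ?_⟩
  · refine ap_sub (e + 1) (2 ^ (e + 1)) (2 ^ e) _ hn ?_ le_rfl m hm Z _ ?_
    · rw [sq]; exact hkk _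
    · have : (2 ^ (e + 1) * 2 ^ ((2 ^ (e + 1)) ^ 2 / 2)) /
          (2 ^ (e + 1) * 2 ^ ((2 ^ (e + 1)) ^ 2 / 2)) = 1 := Nat.div_self (by positivity)
      exact ⟨0, 0, by rw [this]; norm_num, by rw [this]; norm_num, fun x y => by
        rw [zero_mul, zero_add, zero_add]⟩
  · intro k _ hk B hB
    exact ap_sub (e + 1) k (2 ^ e) _ hn (hkk k) hk m hm Z B hB
end

section
/- Let d ≥ 1 and n = 2^d. The number of distinct (n,n,n,n)-affine arrays (as functions (ℤ/Nℤ) × (ℤ/Nℤ) → 𝔽₂ with N = n·2^{n²/2}) equals exactly 2^{n²+n−1}. -/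
theorem MdEnt_zero_row (d j : ℕ) (hj : j < 2 ^ d) : MdEnt d 0 j = 1 := by
  induction d generalizing j with
  | zero => rfl
  | succ d ih =>
    have hp := Nat.two_pow_pos d
    rw [pow_succ] at hj
    simp only [MdEnt, hp, if_true]
    split_ifs with h
    · exact ih _ h
    · exact ih _ (by omega)

theorem MdEnt_lower (d i j : ℕ) (hi : i < 2 ^ d) (hij : j < i) : MdEnt d i j = 0 := by
  induction d generalizing i j with
  | zero => simp at hi; omega
  | succ d ih =>
    rw [pow_succ] at hi
    simp only [MdEnt]
    split_ifs with h1 h2 h2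
    · exact ih _ _ h1 hij
    · omega
    · rfl
    · exact ih _ _ (by omega) (by omega)

theorem sigmaStep_iter {n : ℕ} [NeZero n] (C : Fin n → ZMod 2) (k : ℕ) (i : Fin n) :
    (sigmaStep^[k] C) i = C (i - Fin.ofNat n k) := by
  induction k generalizing C with
  | zero => simp
  | succ k ih =>
    rw [Function.iterate_succ_apply, ih, sigmaStep]
    congr 1
    rw [sub_sub]
    congr 1
    ext
    simp [Fin.val_add]

theorem sigmaStep_iter_top {n : ℕ} [NeZero n] (C : Fin n → ZMod 2) (k : ℕ) (hk : k < n) :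
    (sigmaStep^[k] C) ⟨k, hk⟩ = C 0 := by
  rw [sigmaStep_iter]
  congr 1
  rw [sub_eq_zero]
  ext
  simp [Nat.mod_eq_of_lt hk]

theorem sigmaStep_iter_above {n : ℕ} [NeZero n] (C : Fin n → ZMod 2) (k j : ℕ)
    (hk : k + j < n) (hC : ∀ i : Fin n, j < i → C i = 0) (i : Fin n) (hi : (i : ℕ) < k) :
    (sigmaStep^[k] C) i = 0 := by
  rw [sigmaStep_iter]
  apply hC
  rw [Fin.val_sub]
  simp only [Fin.val_ofNat]
  rw [Nat.mod_eq_of_lt (show k < n by omega), Nat.mod_eq_of_lt (by omega)]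
  omega

theorem Admissible.le {n : ℕ} {m : Fin n → ℕ} (h : Admissible m) :
    ∀ (k : ℕ) (i : Fin n), (i : ℕ) + k = n - 1 → m i ≤ k := by
  intro k
  induction k with
  | zero => intro i hi; rw [h.1 i (by omega)]
  | succ k ih =>
    intro i hi
    have h1 := ih ⟨i + 1, by omega⟩ (by simp; omega)
    have h2 := h.2 i ⟨i + 1, by omega⟩ rfl
    omega

theorem pascalLike_not_lt (d : ℕ) (m m' : Fin (2 ^ d) → ℕ) (hm : Admissible m)
    (hm' : Admissible m') (h : pascalLike d m = pascalLike d m') (j : Fin (2 ^ d)) :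
    ¬ m j < m' j := by
  intro hlt
  have hj := j.2
  have h1 := hm.le (2 ^ d - 1 - j) j (by omega)
  have h2 := hm'.le (2 ^ d - 1 - j) j (by omega)
  have hk : m j < 2 ^ d := by omega
  have e := congrFun (congrFun h ⟨m j, hk⟩) j
  simp only [pascalLike, Matrix.of_apply] at e
  rw [sigmaStep_iter_top, sigmaStep_iter_above _ (m' j) j (by omega) _ _ hlt] at e
  · simp [Md, MdEnt_zero_row d j hj] at e
  · intro i hi
    exact MdEnt_lower d i j i.2 hi

theorem pascalLike_inj (d : ℕ) (m m' : Fin (2 ^ d) → ℕ) (hm : Admissible m)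
    (hm' : Admissible m') (h : pascalLike d m = pascalLike d m') : m = m' := by
  funext j
  have h1 := pascalLike_not_lt d m m' hm hm' h j
  have h2 := pascalLike_not_lt d m' m hm' hm h.symm j
  omega

theorem joinOE_zero : joinOE 0 0 = 0 := by simp [joinOE]

theorem joinOE_two_pow (t : ℕ) : joinOE (2 ^ t) 0 = 2 ^ (2 * t + 1) := by
  unfold joinOE
  rw [Finset.sum_eq_single t]
  · simp
  · intro b _ hb
    simp [Nat.testBit_two_pow_of_ne hb.symm]
  · intro h
    exfalso
    apply h
    have := @Nat.lt_two_pow_self t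
    simp; omega

theorem affineArray_at (d : ℕ) (m Z) (l r : ℕ) (hl : l < 2 ^ ((2 ^ d) ^ 2 / 2))
    (hr : r < 2 ^ ((2 ^ d) ^ 2 / 2)) (i j : Fin (2 ^ d)) :
    affineArray d m Z ((l * 2 ^ d + i : ℕ)) ((r * 2 ^ d + j : ℕ)) =
      (pascalLike d m * Nmat (2 ^ d) (joinOE l r) + Z) i j := by
  have key : ∀ (l : ℕ) (_ : l < 2 ^ ((2 ^ d) ^ 2 / 2)) (i : Fin (2 ^ d)),
      ((l * 2 ^ d + i : ℕ) : ZMod (2 ^ d * 2 ^ ((2 ^ d) ^ 2 / 2))).val = l * 2 ^ d + i := by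
    intro l hl i
    rw [ZMod.val_natCast, Nat.mod_eq_of_lt]
    have := i.2
    calc l * 2 ^ d + i < (l + 1) * 2 ^ d := by rw [add_mul]; omega
      _ ≤ _ := by rw [mul_comm (2 ^ d)]; exact Nat.mul_le_mul_right _ hl
  have hp := Nat.two_pow_pos d
  have dv : ∀ (l : ℕ) (i : Fin (2 ^ d)), (l * 2 ^ d + i) / 2 ^ d = l := by
    intro l i
    rw [mul_comm, Nat.mul_add_div hp, Nat.div_eq_of_lt i.2, add_zero]
  have md : ∀ (l : ℕ) (i : Fin (2 ^ d)), (l * 2 ^ d + i) % 2 ^ d = i := by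
    intro l i
    rw [mul_comm, Nat.mul_add_mod, Nat.mod_eq_of_lt i.2]
  simp only [affineArray, key l hl i, key r hr j, dv, md]

theorem affineArray_inj (d : ℕ) (hd : 1 ≤ d) (m m' Z Z') (hm : Admissible m)
    (hm' : Admissible m') (h : affineArray d m Z = affineArray d m' Z') : m = m' ∧ Z = Z' := by
  have hN : ∀ l r, l < 2 ^ ((2 ^ d) ^ 2 / 2) → r < 2 ^ ((2 ^ d) ^ 2 / 2) →
      pascalLike d m * Nmat (2 ^ d) (joinOE l r) + Z =
      pascalLike d m' * Nmat (2 ^ d) (joinOE l r) + Z' := by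
    intro l r hl hr
    ext i j
    rw [← affineArray_at d m Z l r hl hr, ← affineArray_at d m' Z' l r hl hr, h]
  have hZ : Z = Z' := by
    have h0 := hN 0 0 (by positivity) (by positivity)
    have : Nmat (2 ^ d) (joinOE 0 0) = 0 := by
      ext i j; simp [joinOE_zero, Nmat]
    simpa [this] using h0
  refine ⟨?_, hZ⟩
  subst hZ
  apply pascalLike_inj d m m' hm hm'
  obtain ⟨c, hc⟩ : ∃ c, 2 ^ d = 2 * c := ⟨2 ^ (d - 1), by
    rw [← pow_succ']; congr 1; omega⟩
  ext i j
  have hj := j.2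
  have hp := Nat.two_pow_pos d
  -- the bit position for entry (j, 0)
  have hcpos : 0 < c := by omega
  obtain ⟨t, ht⟩ : ∃ t : ℕ, (2 ^ d) ^ 2 = 2 * t + 2 + (j : ℕ) * 2 ^ d := by
    refine ⟨2 * c * c - 1 - j * c, ?_⟩
    have h1 : (j + 1) * c ≤ 2 * c * c := Nat.mul_le_mul_right _ (by omega)
    have e1 : (2 ^ d) ^ 2 = 2 * (2 * c * c) := by rw [hc]; ring
    have e2 : (j : ℕ) * 2 ^ d = 2 * ((j : ℕ) * c) := by
      calc (j : ℕ) * 2 ^ d = (j : ℕ) * (2 * c) := congrArg (fun x => (j : ℕ) * x) hc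
        _ = _ := by ring
    rw [add_mul] at h1
    rw [e1, e2]
    omega
  have htl : t < (2 ^ d) ^ 2 / 2 := by
    have : 0 ≤ (j : ℕ) * 2 ^ d := Nat.zero_le _
    omega
  have h1 := hN (2 ^ t) 0 (Nat.pow_lt_pow_right (by norm_num) htl) (by positivity)
  have h1' := add_right_cancel h1
  have h2 := congrFun (congrFun h1' i) 0
  rw [joinOE_two_pow] at h2
  have hcol : ∀ a : Fin (2 ^ d), Nmat (2 ^ d) (2 ^ (2 * t + 1)) a 0 = if a = j then 1 else 0 := by
    intro a
    simp only [Nmat, Matrix.of_apply, Nat.testBit_two_pow]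
    have ha := a.2
    have h3 : ((a : ℕ) + 1) * 2 ^ d ≤ (2 ^ d) ^ 2 := by
      rw [pow_two]; exact Nat.mul_le_mul_right _ ha
    rw [add_mul] at h3
    have : (2 * t + 1 = (2 ^ d) ^ 2 - 1 - ((a : ℕ) * 2 ^ d + ((0 : Fin (2 ^ d)) : ℕ))) ↔ a = j := by
      simp only [Fin.val_zero]
      constructor
      · intro h
        ext
        apply Nat.eq_of_mul_eq_mul_right hp
        omega
      · rintro rfl
        omega
    simp only [decide_eq_true_eq, this]
  simpa [Matrix.mul_apply, hcol] using h2

theorem admissible_ncard (n : ℕ) :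
    {m : Fin (n + 1) → ℕ | Admissible m}.ncard = 2 ^ n := by
  have hcard : ((Finset.range n).powerset : Set (Finset ℕ)).ncard = 2 ^ n := by
    rw [Set.ncard_coe_finset]; simp
  rw [← hcard]
  symm
  have hstep : ∀ (S : Finset ℕ) (i : ℕ), (S.filter (i ≤ ·)).card =
      (S.filter (i + 1 ≤ ·)).card + if i ∈ S then 1 else 0 := by
    intro S i
    have : S.filter (i ≤ ·) = S.filter (i + 1 ≤ ·) ∪ S.filter (i = ·) := by
      ext x; simp only [Finset.mem_filter, Finset.mem_union]; grind
    rw [this, Finset.card_union_of_disjoint]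
    · congr 1
      rw [Finset.filter_eq]
      split_ifs <;> simp
    · rw [Finset.disjoint_left]; intro x; simp only [Finset.mem_filter]; omega
  apply Set.ncard_congr (fun S _ => fun i : Fin (n + 1) => (S.filter ((i : ℕ) ≤ ·)).card)
  · intro S hS
    simp only [Finset.coe_powerset, Set.mem_preimage, Set.mem_powerset_iff, Finset.coe_subset] at hS
    refine ⟨?_, ?_⟩
    · intro i hi
      rw [Finset.card_eq_zero, Finset.filter_eq_empty_iff]
      intro x hx
      have := Finset.mem_range.1 (hS hx)
      omega
    · intro i j hij
      have := hstep S i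
      simp only [hij]
      split_ifs at this <;> omega
  · intro S T hS hT h
    simp only [Finset.coe_powerset, Set.mem_preimage, Set.mem_powerset_iff, Finset.coe_subset] at hS hT
    ext x
    by_cases hx : x < n
    · have h1 := congrFun h ⟨x, by omega⟩
      have h2 := congrFun h ⟨x + 1, by omega⟩
      have h3 := hstep S x
      have h4 := hstep T x
      simp only at h1 h2
      rw [h1, h2] at h3
      split_ifs at h3 h4 <;> first | omega | simp [*]
    · constructor
      · intro h; exact absurd (Finset.mem_range.1 (hS h)) hx
      · intro h; exact absurd (Finset.mem_range.1 (hT h)) hx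
  · intro m hm
    refine ⟨(Finset.range n).filter (fun i => m (Fin.ofNat (n + 1) i) ≠ m (Fin.ofNat (n + 1) (i + 1))), ?_, ?_⟩
    · simp only [Finset.coe_powerset, Set.mem_preimage, Set.mem_powerset_iff, Finset.coe_subset]
      exact Finset.filter_subset _ _
    · set S := (Finset.range n).filter (fun i => m (Fin.ofNat (n + 1) i) ≠ m (Fin.ofNat (n + 1) (i + 1))) with hS
      have key : ∀ (k : ℕ) (i : Fin (n + 1)), (i : ℕ) + k = n →
          (S.filter ((i : ℕ) ≤ ·)).card = m i := by
        intro k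
        induction k with
        | zero =>
          intro i hi
          rw [hm.1 i (by omega), Finset.card_eq_zero, Finset.filter_eq_empty_iff]
          intro x hx
          have := Finset.mem_range.1 (Finset.mem_filter.1 hx).1
          omega
        | succ k ih =>
          intro i hi
          have h1 := ih ⟨i + 1, by omega⟩ (by simp; omega)
          have h2 := hm.2 i ⟨i + 1, by omega⟩ rfl
          rw [hstep]
          simp only at h1
          rw [h1]
          have e1 : Fin.ofNat (n + 1) (i : ℕ) = i := by ext; simp
          have e2 : Fin.ofNat (n + 1) ((i : ℕ) + 1) = ⟨i + 1, by omega⟩ := by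
            ext; simp only [Fin.val_ofNat]; exact Nat.mod_eq_of_lt (by omega)
          have hmem : (i : ℕ) ∈ S ↔ m i ≠ m ⟨i + 1, by omega⟩ := by
            rw [hS, Finset.mem_filter, e1, e2, Finset.mem_range]
            exact ⟨fun h => h.2, fun h => ⟨by omega, h⟩⟩
          split_ifs with hi'
          · have := hmem.1 hi'
            omega
          · have := not_not.1 (fun h => hi' (hmem.2 h))
            omega
      funext i
      exact key (n - i) i (by omega)

/-- For `d ≥ 1` and `n = 2^d`, the number of distinct
`(n,n,n,n)`-affine arrays equals exactly `2^{n²+n−1}`. -/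
theorem card_affineArrays (d : ℕ) (hd : 1 ≤ d) :
    {A : ZMod (2 ^ d * 2 ^ ((2 ^ d) ^ 2 / 2)) →
          ZMod (2 ^ d * 2 ^ ((2 ^ d) ^ 2 / 2)) → ZMod 2 |
        ∃ m Z, Admissible m ∧ A = affineArray d m Z}.ncard
      = 2 ^ ((2 ^ d) ^ 2 + 2 ^ d - 1) := by
  have hp := Nat.two_pow_pos d
  have hset : {A : ZMod (2 ^ d * 2 ^ ((2 ^ d) ^ 2 / 2)) →
          ZMod (2 ^ d * 2 ^ ((2 ^ d) ^ 2 / 2)) → ZMod 2 |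
        ∃ m Z, Admissible m ∧ A = affineArray d m Z} =
      (fun p : (Fin (2 ^ d) → ℕ) × Matrix (Fin (2 ^ d)) (Fin (2 ^ d)) (ZMod 2) =>
        affineArray d p.1 p.2) '' ({m | Admissible m} ×ˢ Set.univ) := by
    ext A
    constructor
    · rintro ⟨m, Z, hm, rfl⟩
      exact ⟨(m, Z), ⟨hm, trivial⟩, rfl⟩
    · rintro ⟨⟨m, Z⟩, ⟨hm, -⟩, rfl⟩
      exact ⟨m, Z, hm, rfl⟩
  rw [hset, Set.ncard_image_of_injOn, Set.ncard_prod, Set.ncard_univ]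
  · have h1 : ∀ N, 0 < N → {m : Fin N → ℕ | Admissible m}.ncard = 2 ^ (N - 1) := by
      intro N hN
      obtain ⟨n, rfl⟩ : ∃ n, N = n + 1 := ⟨N - 1, by omega⟩
      exact admissible_ncard n
    have h2 : Nat.card (Matrix (Fin (2 ^ d)) (Fin (2 ^ d)) (ZMod 2)) = 2 ^ ((2 ^ d) ^ 2) := by
      change Nat.card (Fin (2 ^ d) → Fin (2 ^ d) → ZMod 2) = _
      simp [Nat.card_eq_fintype_card, ← pow_mul, pow_two]
    rw [h1 _ hp, h2, ← pow_add]
    congr 1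
    omega
  · rintro ⟨m, Z⟩ ⟨hm, -⟩ ⟨m', Z'⟩ ⟨hm', -⟩ h
    obtain ⟨h1, h2⟩ := affineArray_inj d hd m m' Z Z' hm hm' h
    rw [h1, h2]
end

section
/- Let d ≥ 0, n = 2^d, and let m_0,…,m_{n−1} be an admissible sequence for a Pascal-like matrix. Define τ : {0,…,n−1} → {0,…,n−1} by τ(i) = m_i if i = 0 or m_{i−1} = m_i + 1, and τ(i) = m_i + i otherwise (i.e. when i > 0 and m_{i−1} = m_i). Then τ is a bijection of {0,…,n−1} onto itself. -/
/-- For an admissible sequence `m_0,…,m_{n−1}` (`n = 2^d`), the map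
`τ(i) = m_i` if `i = 0` or `m_{i−1} = m_i + 1`, and `τ(i) = m_i + i` otherwise
(i.e. `i > 0` and `m_{i−1} = m_i`), is a bijection of `{0,…,n−1}` onto itself. -/
theorem tau_bijective (d : ℕ) (m : Fin (2 ^ d) → ℕ) (hm : Admissible m)
    (τ : Fin (2 ^ d) → ℕ)
    (hτ1 : ∀ i : Fin (2 ^ d),
      ((i : ℕ) = 0 ∨ ∃ j : Fin (2 ^ d), (j : ℕ) + 1 = (i : ℕ) ∧ m j = m i + 1) →
        τ i = m i)
    (hτ2 : ∀ i : Fin (2 ^ d),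
      ((i : ℕ) ≠ 0 ∧ ∀ j : Fin (2 ^ d), (j : ℕ) + 1 = (i : ℕ) → m j = m i) →
        τ i = m i + (i : ℕ)) :
    Set.BijOn τ Set.univ (Set.Iio (2 ^ d)) := by
  obtain ⟨h0, h1⟩ := hm
  have key : ∀ k : ℕ, ∀ i j : Fin (2 ^ d), (j : ℕ) = (i : ℕ) + k →
      m j ≤ m i ∧ m i + (i : ℕ) ≤ m j + (j : ℕ) := by
    intro k
    induction k with
    | zero =>
      intro i j h
      have : i = j := Fin.ext (by omega)
      subst this
      simp
    | succ k ih =>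
      intro i j h
      have hj := j.2
      have a := ih i ⟨(i : ℕ) + k, by omega⟩ rfl
      have b := h1 ⟨(i : ℕ) + k, by omega⟩ j (by simp only; omega)
      simp only at a
      omega
  have dich : ∀ i : Fin (2 ^ d), ((i : ℕ) = 0 ∧ τ i = m i) ∨
      (∃ j : Fin (2 ^ d), (j : ℕ) + 1 = (i : ℕ) ∧ m j = m i + 1 ∧ τ i = m i) ∨
      (∃ j : Fin (2 ^ d), (j : ℕ) + 1 = (i : ℕ) ∧ m j = m i ∧ τ i = m i + (i : ℕ)) := by
    intro i
    have hi := i.2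
    by_cases hz : (i : ℕ) = 0
    · exact Or.inl ⟨hz, hτ1 i (Or.inl hz)⟩
    · right
      obtain ⟨j, hj⟩ : ∃ j : Fin (2 ^ d), (j : ℕ) + 1 = (i : ℕ) :=
        ⟨⟨(i : ℕ) - 1, by omega⟩, by simp only; omega⟩
      have b := h1 j i hj.symm
      by_cases hc : m j = m i + 1
      · exact Or.inl ⟨j, hj, hc, hτ1 i (Or.inr ⟨j, hj, hc⟩)⟩
      · refine Or.inr ⟨j, hj, by omega, hτ2 i ⟨hz, fun j' hj' => ?_⟩⟩
        have : j' = j := Fin.ext (by omega)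
        subst this
        omega
  have hlt : ∀ i, τ i < 2 ^ d := by
    intro i
    have hi := i.2
    have a := key (2 ^ d - 1 - (i : ℕ)) i ⟨2 ^ d - 1, by omega⟩ (by simp only; omega)
    have b := h0 ⟨2 ^ d - 1, by omega⟩ rfl
    simp only at a
    rcases dich i with h | ⟨j, h⟩ | ⟨j, h⟩ <;> omega
  have hne : ∀ i j : Fin (2 ^ d), (i : ℕ) < (j : ℕ) → τ i ≠ τ j := by
    intro i j hij
    rcases dich j with hj | ⟨p, hj⟩ | ⟨p, hj⟩
    · omega
    all_goals
      have a := key ((p : ℕ) - (i : ℕ)) i p (by omega)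
      rcases dich i with hi | ⟨q, hi⟩ | ⟨q, hi⟩ <;> omega
  have hinj : Function.Injective τ := by
    intro i j h
    rcases lt_trichotomy (i : ℕ) (j : ℕ) with hl | he | hg
    · exact absurd h (hne i j hl)
    · exact Fin.ext he
    · exact absurd h.symm (hne j i hg)
  refine ⟨fun i _ => hlt i, hinj.injOn, ?_⟩
  have hinj' : Function.Injective (fun i => (⟨τ i, hlt i⟩ : Fin (2 ^ d))) :=
    fun i j h => hinj (congrArg Fin.val h)
  intro x hx
  obtain ⟨i, hi⟩ := (Finite.injective_iff_surjective.mp hinj') ⟨x, hx⟩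
  exact ⟨i, trivial, congrArg Fin.val hi⟩
end
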